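/- arXiv:1906.01289 — 3 statements merged into one kernel-verified Lean document; each statement's English description precedes it below -/
import Mathlib

section
/- Let d ≥ 1, m > 1, m* = m/(m−1), and suppose (b,V) satisfies hypothesis (H1) with parameters δ = 0, ρ > 0, a ∈ ℝ, η > 0, R > 0. Then lim_{β→∞} λ_max(β) = ρ^{m*}/m*. -/
open Filter Real RealInnerProductSpace

noncomputable section

abbrev Euc (d : ℕ) := EuclideanSpace ℝ (Fin d)

/-- The Laplacian of `φ`, defined as the sum of the second partial derivatives
in the coordinate directions. -/
def lap {d : ℕ} (φ : Euc d → ℝ) (x : Euc d) : ℝ :=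
  ∑ i : Fin d, fderiv ℝ (fun y => fderiv ℝ φ y (EuclideanSpace.single i 1)) x
    (EuclideanSpace.single i 1)

/-- `(lam, φ)` is a subsolution of the ergodic problem (EP). -/
def IsSubsol {d : ℕ} (m : ℝ) (b : Euc d → Euc d) (V : Euc d → ℝ) (β lam : ℝ)
    (φ : Euc d → ℝ) : Prop :=
  ContDiff ℝ 3 φ ∧ ∀ x : Euc d,
    lam - lap φ x + ⟪b x, gradient φ x⟫ + (1 / m) * ‖gradient φ x‖ ^ m - β * V x ≤ 0

/-- The generalized principal eigenvalue `λ_max(β)`. -/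
def lamMax {d : ℕ} (m : ℝ) (b : Euc d → Euc d) (V : Euc d → ℝ) (β : ℝ) : ℝ :=
  sSup {lam : ℝ | ∃ φ : Euc d → ℝ, IsSubsol m b V β lam φ}

/-- Hypothesis (H0) with parameter `δ` and constants `ρ, R` and auxiliary function `α`. -/
def HypH0 {d : ℕ} (δ ρ R : ℝ) (b : Euc d → Euc d) (V : Euc d → ℝ) (α : Euc d → ℝ) : Prop :=
  ContDiff ℝ 2 b ∧ ContDiff ℝ 2 V ∧ (∃ M : ℝ, ∀ x : Euc d, ‖gradient V x‖ ≤ M) ∧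
  ContDiff ℝ 2 α ∧
  (∀ x : Euc d, R ≤ ‖x‖ → b x = ((ρ + α x) * ‖x‖ ^ (δ - 1)) • x) ∧
  Tendsto α (cocompact (Euc d)) (nhds 0) ∧
  (∀ x : Euc d, 0 ≤ V x) ∧
  Metric.closedBall (0 : Euc d) R ⊆ interior (Function.support V) ∧
  Tendsto V (cocompact (Euc d)) (nhds 0)

/-- Hypothesis (H1): (H0) together with `α(x) = a|x|⁻¹` and `V(x) = |x|^{-η}` outside `B_R`. -/
def HypH1 {d : ℕ} (δ ρ R a η : ℝ) (b : Euc d → Euc d) (V : Euc d → ℝ) (α : Euc d → ℝ) : Prop :=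
  HypH0 δ ρ R b V α ∧
  ∀ x : Euc d, R ≤ ‖x‖ → α x = a * ‖x‖⁻¹ ∧ V x = ‖x‖ ^ (-η)




theorem radial_grad {d : ℕ} (x0 x : Euc d) (g g1 : ℝ → ℝ)
    (h : HasDerivAt g (g1 (‖x - x0‖ ^ 2)) (‖x - x0‖ ^ 2)) :
    HasFDerivAt (fun y : Euc d => g (‖y - x0‖ ^ 2))
      (g1 (‖x - x0‖ ^ 2) • ((2 : ℝ) • innerSL ℝ (x - x0))) x := by
  have h1 : HasFDerivAt (fun y : Euc d => ‖y - x0‖ ^ 2) ((2 : ℝ) • innerSL ℝ (x - x0)) x := by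
    have := (HasFDerivAt.norm_sq ((hasFDerivAt_id x).sub_const x0))
    refine this.congr_fderiv ?_
    ext v
    simp [two_smul]
  exact h.comp_hasFDerivAt x h1

theorem radial_gradient {d : ℕ} (x0 x : Euc d) (g g1 : ℝ → ℝ)
    (h : HasDerivAt g (g1 (‖x - x0‖ ^ 2)) (‖x - x0‖ ^ 2)) :
    gradient (fun y : Euc d => g (‖y - x0‖ ^ 2)) x = (2 * g1 (‖x - x0‖ ^ 2)) • (x - x0) := by
  apply HasGradientAt.gradient
  rw [hasGradientAt_iff_hasFDerivAt]
  refine (radial_grad x0 x g g1 h).congr_fderiv ?_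
  ext v
  simp
  ring

theorem radial_lap {d : ℕ} (x0 x : Euc d) (g g1 g2 : ℝ → ℝ) 
    (h : ∀ᶠ s in nhds (‖x - x0‖ ^ 2), HasDerivAt g (g1 s) s)
    (h2 : HasDerivAt g1 (g2 (‖x - x0‖ ^ 2)) (‖x - x0‖ ^ 2)) :
    lap (fun y : Euc d => g (‖y - x0‖ ^ 2)) x =
      4 * g2 (‖x - x0‖ ^ 2) * ‖x - x0‖ ^ 2 + 2 * d * g1 (‖x - x0‖ ^ 2) := by
  unfold lap
  have hc : ContinuousAt (fun y : Euc d => ‖y - x0‖ ^ 2) x := by fun_prop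
  have key : ∀ i : Fin d, fderiv ℝ (fun y => fderiv ℝ (fun y : Euc d => g (‖y - x0‖ ^ 2)) y
      (EuclideanSpace.single i 1)) x (EuclideanSpace.single i 1) =
      4 * g2 (‖x - x0‖ ^ 2) * ((x - x0) i) ^ 2 + 2 * g1 (‖x - x0‖ ^ 2) := by
    intro i
    have e : (fun y => fderiv ℝ (fun y : Euc d => g (‖y - x0‖ ^ 2)) y
      (EuclideanSpace.single i 1)) =ᶠ[nhds x]
        fun y => g1 (‖y - x0‖ ^ 2) * (2 * inner ℝ (EuclideanSpace.single i 1 : Euc d) (y - x0)) := by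
      filter_upwards [hc.eventually h] with y hy
      rw [(radial_grad x0 y g g1 hy).fderiv]
      rw [real_inner_comm]
      simp only [smul_apply, innerSL_apply_apply, smul_eq_mul]
    rw [e.fderiv_eq]
    have h3 := radial_grad x0 x g1 g2 h2
    have h4 : HasFDerivAt (fun y : Euc d => 2 * inner ℝ (EuclideanSpace.single i 1 : Euc d) (y - x0))
        ((2 : ℝ) • innerSL ℝ (EuclideanSpace.single i 1 : Euc d)) x := by
      have := ((innerSL ℝ (EuclideanSpace.single i 1 : Euc d)).hasFDerivAt (x := x - x0)).comp x
        ((hasFDerivAt_id x).sub_const x0)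
      exact (this.const_mul 2).congr_fderiv (by ext v; simp)
    rw [HasFDerivAt.fderiv (h3.fun_mul h4)]
    simp [EuclideanSpace.inner_single_left, EuclideanSpace.inner_single_right]
    ring
  rw [Finset.sum_congr rfl (fun i _ => key i), Finset.sum_add_distrib, ← Finset.mul_sum,
    EuclideanSpace.real_norm_sq_eq]
  simp
  ring

theorem second_deriv_max (f f1 : ℝ → ℝ) (c : ℝ) (h : ∀ᶠ t in nhds 0, HasDerivAt f (f1 t) t)
    (h1 : HasDerivAt f1 c 0) (hm : IsLocalMax f 0) : c ≤ 0 := by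
  by_contra hc
  push Not at hc
  have e : deriv f =ᶠ[nhds 0] f1 := h.mono fun t ht => ht.deriv
  have hdd : deriv (deriv f) 0 = c := by rw [e.deriv_eq, h1.deriv]
  have hmin := isLocalMin_of_deriv_deriv_pos (by rw [hdd]; exact hc) hm.deriv_eq_zero
    h.self_of_nhds.continuousAt
  have hconst : f =ᶠ[nhds 0] fun _ => f 0 := by
    filter_upwards [hm, hmin] with t h1 h2 using le_antisymm h1 h2
  have := hconst.deriv.deriv_eq
  simp only [hdd, deriv_const', deriv_const] at this
  linarith

theorem lap_max {d : ℕ} (f w : Euc d → ℝ) (x : Euc d) (hf : ContDiffAt ℝ 2 f x)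
    (hw : ContDiffAt ℝ 2 w x) (hm : IsLocalMax (fun y => f y - w y) x) :
    gradient f x = gradient w x ∧ lap f x ≤ lap w x := by
  have hfd := hf.differentiableAt (by norm_num)
  have hwd := hw.differentiableAt (by norm_num)
  constructor
  · have := hm.fderiv_eq_zero
    rw [fderiv_fun_sub hfd hwd, sub_eq_zero] at this
    unfold gradient
    rw [this]
  · unfold lap
    apply Finset.sum_le_sum
    intro i _
    set e : Euc d := EuclideanSpace.single i 1
    have line : ∀ t : ℝ, HasDerivAt (fun t : ℝ => x + t • e) e t := by
      intro t
      simpa using ((hasDerivAt_id t).smul_const e).const_add x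
    have hl : Tendsto (fun t : ℝ => x + t • e) (nhds 0) (nhds x) := by
      have := (line 0).continuousAt
      simpa [ContinuousAt] using this
    have ev : ∀ {u : Euc d → ℝ}, ContDiffAt ℝ 2 u x → 
        ∀ᶠ t in nhds (0:ℝ), HasDerivAt (fun t : ℝ => u (x + t • e)) (fderiv ℝ u (x + t • e) e) t := by
      intro u hu
      have h := hu.eventually (by simp)
      filter_upwards [hl.eventually h] with t ht
      exact (ht.differentiableAt (by norm_num)).hasFDerivAt.comp_hasDerivAt t (line t)
    have sec : ∀ {u : Euc d → ℝ}, ContDiffAt ℝ 2 u x → 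
        HasDerivAt (fun t : ℝ => fderiv ℝ u (x + t • e) e)
          (fderiv ℝ (fun y => fderiv ℝ u y e) x e) 0 := by
      intro u hu
      have h1 : ContDiffAt ℝ 1 (fderiv ℝ u) x := hu.fderiv_right (by norm_num)
      have h2 : DifferentiableAt ℝ (fun y => fderiv ℝ u y e) x :=
        (h1.differentiableAt (by norm_num)).clm_apply (differentiableAt_const e)
      have h3 : HasFDerivAt (fun y => fderiv ℝ u y e) (fderiv ℝ (fun y => fderiv ℝ u y e) x)
        (x + (0:ℝ) • e) := by simpa using h2.hasFDerivAt
      exact h3.comp_hasDerivAt (0:ℝ) (line 0)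
    have := second_deriv_max (fun t => f (x + t • e) - w (x + t • e)) 
      (fun t => fderiv ℝ f (x + t • e) e - fderiv ℝ w (x + t • e) e) _
      (by filter_upwards [ev hf, ev hw] with t h1 h2 using h1.sub h2)
      ((sec hf).sub (sec hw))
      (by
        have : ∀ᶠ t in nhds (0:ℝ), f (x + t • e) - w (x + t • e) ≤ f x - w x := hl.eventually hm
        filter_upwards [this] with t ht
        simpa using ht)
    linarith

theorem barrier_max {d : ℕ} (φ : Euc d → ℝ) (hφ : Continuous φ) (x0 : Euc d) (r γ : ℝ) (hr : 0 < r)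
    (hγ : 0 < γ) : ∃ x : Euc d, ‖x - x0‖ < r ∧
      IsLocalMax (fun y => φ y - r * (1 - ‖y - x0‖ ^ 2 / r ^ 2) ^ (-γ)) x := by
  obtain ⟨M, hM⟩ := (isCompact_closedBall x0 r).bddAbove_image hφ.continuousOn
  have hM' : ∀ y : Euc d, ‖y - x0‖ ≤ r → φ y ≤ M := fun y hy =>
    hM ⟨y, by rwa [mem_closedBall_iff_norm], rfl⟩
  have hx0 : φ x0 ≤ M := hM' x0 (by simpa using hr.le)
  set A : ℝ := 2 + (M - φ x0) / r with hA
  have hA1 : 1 < A := by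
    have : 0 ≤ (M - φ x0) / r := div_nonneg (by linarith) hr.le
    linarith
  set c : ℝ := A ^ (-(1 / γ)) with hc
  have hcp : 0 < c := rpow_pos_of_pos (by linarith) _
  have hc1 : c < 1 := rpow_lt_one_of_one_lt_of_neg hA1 (by simp [hγ])
  have hcg : c ^ (-γ) = A := by
    rw [hc, ← rpow_mul (by linarith)]
    have : -(1 / γ) * -γ = 1 := by field_simp
    rw [this, rpow_one]
  have hcont : Continuous (fun y : Euc d => 1 - ‖y - x0‖ ^ 2 / r ^ 2) := by fun_prop
  have hball : ∀ y : Euc d, c ≤ 1 - ‖y - x0‖ ^ 2 / r ^ 2 → ‖y - x0‖ < r := by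
    intro y hy
    have h1 : ‖y - x0‖ ^ 2 / r ^ 2 < 1 := by linarith
    rw [div_lt_one (by positivity)] at h1
    exact lt_of_pow_lt_pow_left₀ 2 hr.le h1
  set S : Set (Euc d) := {y | c ≤ 1 - ‖y - x0‖ ^ 2 / r ^ 2} with hS
  have hSc : IsCompact S := by
    apply (isCompact_closedBall x0 r).of_isClosed_subset (isClosed_le continuous_const hcont)
    intro y hy
    rw [mem_closedBall_iff_norm]; exact (hball y hy).le
  have hx0S : x0 ∈ S := by simp [hS, hc1.le]
  obtain ⟨x, hxS, hx⟩ := hSc.exists_isMaxOn ⟨x0, hx0S⟩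
    (f := fun y => φ y - r * (1 - ‖y - x0‖ ^ 2 / r ^ 2) ^ (-γ))
    (hφ.continuousOn.sub (continuousOn_const.mul
      (hcont.continuousOn.rpow_const fun y hy => Or.inl (lt_of_lt_of_le hcp hy).ne')))
  refine ⟨x, hball x hxS, ?_⟩
  have hlt : c < 1 - ‖x - x0‖ ^ 2 / r ^ 2 := by
    rcases lt_or_eq_of_le (show c ≤ 1 - ‖x - x0‖ ^ 2 / r ^ 2 from hxS) with h | h
    · exact h
    · exfalso
      have h1 : φ x0 - r * (1 - ‖x0 - x0‖ ^ 2 / r ^ 2) ^ (-γ) ≤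
        φ x - r * (1 - ‖x - x0‖ ^ 2 / r ^ 2) ^ (-γ) := hx hx0S
      rw [← h, hcg] at h1
      simp at h1
      have h2 := hM' x (hball x hxS).le
      have h3 : r * A = 2 * r + (M - φ x0) := by rw [hA]; field_simp
      linarith
  have : S ∈ nhds x := by
    filter_upwards [(isOpen_lt continuous_const hcont).mem_nhds hlt] with y hy
    exact le_of_lt hy
  exact hx.isLocalMax this

theorem barrier_est (d : ℕ) (m γ : ℝ) (hm : 1 < m) (hγ : γ = 1 / (m - 1)) :
    ∃ K : ℝ, 0 < K ∧ ∀ r n : ℝ, 0 < r → 0 ≤ n → n < r →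
      4 * (γ * (γ + 1) / r ^ 3 * (1 - n ^ 2 / r ^ 2) ^ (-γ - 2)) * n ^ 2 
        + 2 * d * (γ / r * (1 - n ^ 2 / r ^ 2) ^ (-γ - 1)) ≤
      K / r * (1 + (2 * (γ / r * (1 - n ^ 2 / r ^ 2) ^ (-γ - 1)) * n) ^ m) := by
  have hγp : 0 < γ := by rw [hγ]; apply one_div_pos.2; linarith
  have hγm : γ * (m - 1) = 1 := by rw [hγ]; field_simp [show m - 1 ≠ 0 by linarith]
  set C : ℝ := 4 * γ * (γ + 1) + 2 * d * γ with hC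
  have hCp : 0 < C := by positivity
  have hgm : 0 < γ ^ m := rpow_pos_of_pos hγp _
  refine ⟨C * (1 / 2) ^ (-γ - 2) + C / γ ^ m, by positivity, ?_⟩
  intro r n hr hn hnr
  obtain ⟨y, rfl⟩ : ∃ y, n = r * y := ⟨n / r, by field_simp⟩
  have hy0 : 0 ≤ y := nonneg_of_mul_nonneg_right hn hr
  have hy1 : y < 1 := by nlinarith
  have e1 : 1 - (r * y) ^ 2 / r ^ 2 = 1 - y ^ 2 := by field_simp
  rw [e1]
  set u := 1 - y ^ 2 with hu
  have hup : 0 < u := by nlinarith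
  have hu1 : u ≤ 1 := by nlinarith
  have e2 : 2 * (γ / r * u ^ (-γ - 1)) * (r * y) = 2 * γ * y * u ^ (-γ - 1) := by field_simp
  rw [e2]
  have hle : u ^ (-γ - 1) ≤ u ^ (-γ - 2) := rpow_le_rpow_of_exponent_ge hup hu1 (by linarith)
  have hP := rpow_pos_of_pos hup (-γ - 1)
  have hQ := rpow_pos_of_pos hup (-γ - 2)
  have hL : 4 * (γ * (γ + 1) / r ^ 3 * u ^ (-γ - 2)) * (r * y) ^ 2 
        + 2 * d * (γ / r * u ^ (-γ - 1)) ≤ C / r * u ^ (-γ - 2) := by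
    have : 4 * (γ * (γ + 1) / r ^ 3 * u ^ (-γ - 2)) * (r * y) ^ 2 
        + 2 * d * (γ / r * u ^ (-γ - 1)) = 
        (4 * γ * (γ + 1) * (y ^ 2 * u ^ (-γ - 2)) + 2 * d * γ * u ^ (-γ - 1)) / r := by
      field_simp
    rw [this, div_mul_eq_mul_div, hC, add_mul]
    have h1 : y ^ 2 * u ^ (-γ - 2) ≤ u ^ (-γ - 2) := by nlinarith
    gcongr
  refine hL.trans ?_
  have hpm : 0 ≤ (2 * γ * y * u ^ (-γ - 1)) ^ m := by positivity
  rw [div_mul_eq_mul_div, div_mul_eq_mul_div]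
  apply div_le_div_of_nonneg_right _ hr.le
  have hD1 : 0 ≤ C * (1 / 2 : ℝ) ^ (-γ - 2) := by positivity
  have hD2 : 0 ≤ C / γ ^ m := by positivity
  rcases le_total (1 / 2) u with h | h
  · have : u ^ (-γ - 2) ≤ (1 / 2 : ℝ) ^ (-γ - 2) :=
      rpow_le_rpow_of_nonpos (by norm_num) h (by linarith)
    nlinarith
  · have hy2 : 1 ≤ 2 * y := by nlinarith
    have h1 : γ ^ m * u ^ (-γ - 2) ≤ (2 * γ * y * u ^ (-γ - 1)) ^ m := by
      calc γ ^ m * u ^ (-γ - 2) ≤ γ ^ m * u ^ ((-γ - 1) * m) := by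
            exact mul_le_mul_of_nonneg_left
              (rpow_le_rpow_of_exponent_ge hup hu1 (by linarith)) hgm.le
        _ = (γ * u ^ (-γ - 1)) ^ m := by
            rw [mul_rpow hγp.le hP.le, ← rpow_mul hup.le]
        _ ≤ _ := by
            apply rpow_le_rpow (by positivity) _ (by linarith)
            apply mul_le_mul_of_nonneg_right _ hP.le
            nlinarith
    have h2 : C * u ^ (-γ - 2) ≤ C / γ ^ m * (2 * γ * y * u ^ (-γ - 1)) ^ m := by
      rw [div_mul_eq_mul_div, le_div_iff₀ hgm]
      have := mul_le_mul_of_nonneg_left h1 hCp.le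
      linarith
    have h3 := mul_nonneg hD1 hpm
    linarith

theorem young_est (m mst B t q : ℝ) (hm : 1 < m) (hmst : mst = m / (m - 1)) (hB : 0 ≤ B)
    (ht1 : t < 1) (hq : 0 ≤ q) :
    B * q ≤ (1 - t) ^ m * q ^ m / m + (B / (1 - t)) ^ mst / mst := by
  have hc : Real.HolderConjugate m mst := (Real.holderConjugate_iff_eq_conjExponent hm).2 hmst
  have h := Real.young_inequality_of_nonneg (a := (1 - t) * q) (b := B / (1 - t))
    (mul_nonneg (by linarith) hq) (div_nonneg hB (by linarith)) hc
  have e : (1 - t) * q * (B / (1 - t)) = B * q := by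
    field_simp [show 1 - t ≠ 0 by linarith]
  rw [e, mul_rpow (by linarith) hq] at h
  exact h

theorem upper_bound {d : ℕ} (hd : 1 ≤ d) (m ρ mst : ℝ) (hm : 1 < m) (hρ : 0 < ρ)
    (hmst : mst = m / (m - 1)) (b : Euc d → Euc d) (V : Euc d → ℝ) (β lam : ℝ) (φ : Euc d → ℝ)
    (hsub : IsSubsol m b V β lam φ)
    (hb : ∀ ε > 0, ∃ L : ℝ, ∀ x : Euc d, L ≤ ‖x‖ → ‖b x‖ ≤ ρ + ε)
    (hV : ∀ ε > 0, ∃ L : ℝ, ∀ x : Euc d, L ≤ ‖x‖ → β * V x ≤ ε) : lam ≤ ρ ^ mst / mst := by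
  have hmst0 : 0 < mst := by rw [hmst]; exact div_pos (by linarith) (by linarith)
  have key : ∀ t : ℝ, 0 < t → t < 1 → lam ≤ t + ((ρ + t) / (1 - t)) ^ mst / mst + t := by
    intro t ht ht1
    set γ : ℝ := 1 / (m - 1) with hγ
    have hγp : 0 < γ := by rw [hγ]; apply one_div_pos.2; linarith
    obtain ⟨K, hK, hest⟩ := barrier_est d m γ hm hγ
    have hlt : (1 - t) ^ m < 1 := rpow_lt_one (by linarith) (by linarith) (by linarith)
    obtain ⟨r, hr, hr1, hr2⟩ : ∃ r : ℝ, 0 < r ∧ K / r ≤ t ∧ K / r ≤ (1 - (1 - t) ^ m) / m := by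
      have h1 : Tendsto (fun r : ℝ => K / r) atTop (nhds 0) := tendsto_const_nhds.div_atTop tendsto_id
      have e1 := h1.eventually (ge_mem_nhds ht)
      have e2 := h1.eventually (ge_mem_nhds (show 0 < (1 - (1 - t) ^ m) / m from
        div_pos (by linarith) (by linarith)))
      obtain ⟨r, h⟩ := ((eventually_gt_atTop (0:ℝ)).and (e1.and e2)).exists
      exact ⟨r, h.1, h.2.1, h.2.2⟩
    obtain ⟨L1, hL1⟩ := hb t ht
    obtain ⟨L2, hL2⟩ := hV t ht
    obtain ⟨x0, hx0⟩ : ∃ x0 : Euc d, max L1 L2 + r ≤ ‖x0‖ := by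
      refine ⟨EuclideanSpace.single ⟨0, hd⟩ (max L1 L2 + r), ?_⟩
      simpa using le_abs_self _
    obtain ⟨x, hxr, hmax⟩ := barrier_max φ hsub.1.continuous x0 r γ hr hγp
    have hxL : max L1 L2 ≤ ‖x‖ := by
      have h1 : ‖x0‖ ≤ ‖x‖ + ‖x - x0‖ := by
        have := norm_sub_le x (x - x0)
        simpa using this
      linarith
    have hB := hL1 x ((le_max_left _ _).trans hxL)
    have hVx := hL2 x ((le_max_right _ _).trans hxL)
    have hsx : ‖x - x0‖ ^ 2 < r ^ 2 := by
      have := norm_nonneg (x - x0)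
      nlinarith
    have hder : ∀ (c e : ℝ) (s : ℝ), s < r ^ 2 → HasDerivAt (fun s : ℝ => c * (1 - s / r ^ 2) ^ e)
        (c * (-(1 / r ^ 2) * e * (1 - s / r ^ 2) ^ (e - 1))) s := by
      intro c e s hs
      have hu : 1 - s / r ^ 2 ≠ 0 := by
        have : s / r ^ 2 < 1 := by rwa [div_lt_one (by positivity)]
        linarith
      have h1 : HasDerivAt (fun s : ℝ => 1 - s / r ^ 2) (-(1 / r ^ 2)) s :=
        ((hasDerivAt_id s).div_const (r ^ 2)).const_sub 1
      exact (h1.rpow_const (Or.inl hu)).const_mul c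
    have hd1 : ∀ s : ℝ, s < r ^ 2 → HasDerivAt (fun s : ℝ => r * (1 - s / r ^ 2) ^ (-γ))
        ((fun s => γ / r * (1 - s / r ^ 2) ^ (-γ - 1)) s) s := by
      intro s hs
      refine (hder r (-γ) s hs).congr_deriv ?_
      field_simp
    have hd2 : ∀ s : ℝ, s < r ^ 2 → HasDerivAt (fun s : ℝ => γ / r * (1 - s / r ^ 2) ^ (-γ - 1))
        ((fun s => γ * (γ + 1) / r ^ 3 * (1 - s / r ^ 2) ^ (-γ - 2)) s) s := by
      intro s hs
      refine (hder (γ / r) (-γ - 1) s hs).congr_deriv ?_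
      have : -γ - 1 - 1 = -γ - 2 := by ring
      rw [this]
      field_simp
      ring
    have hu : 1 - ‖x - x0‖ ^ 2 / r ^ 2 ≠ 0 := by
      have : ‖x - x0‖ ^ 2 / r ^ 2 < 1 := by rwa [div_lt_one (by positivity)]
      linarith
    have hw : ContDiffAt ℝ 2 (fun y : Euc d => r * (1 - ‖y - x0‖ ^ 2 / r ^ 2) ^ (-γ)) x := by
      apply contDiffAt_const.mul
      refine ContDiffAt.rpow_const_of_ne (f := fun y : Euc d => 1 - ‖y - x0‖ ^ 2 / r ^ 2) ?_ hu
      exact (contDiffAt_const.sub (((contDiffAt_id.sub contDiffAt_const).norm_sq ℝ).div_const _))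
    obtain ⟨hg, hl⟩ := lap_max φ _ x (hsub.1.contDiffAt.of_le (by norm_num)) hw hmax
    rw [radial_gradient x0 x (fun s : ℝ => r * (1 - s / r ^ 2) ^ (-γ))
      (fun s => γ / r * (1 - s / r ^ 2) ^ (-γ - 1)) (hd1 _ hsx)] at hg
    rw [radial_lap x0 x (fun s : ℝ => r * (1 - s / r ^ 2) ^ (-γ))
      (fun s => γ / r * (1 - s / r ^ 2) ^ (-γ - 1)) 
      (fun s => γ * (γ + 1) / r ^ 3 * (1 - s / r ^ 2) ^ (-γ - 2))
      (by filter_upwards [gt_mem_nhds hsx] with s hs using hd1 s hs) (hd2 _ hsx)] at hl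
    have hE := hest r ‖x - x0‖ hr (norm_nonneg _) hxr
    have hup : 0 ≤ 1 - ‖x - x0‖ ^ 2 / r ^ 2 := by
      have : ‖x - x0‖ ^ 2 / r ^ 2 < 1 := by rwa [div_lt_one (by positivity)]
      linarith
    have hn : ‖gradient φ x‖ =
        2 * (γ / r * (1 - ‖x - x0‖ ^ 2 / r ^ 2) ^ (-γ - 1)) * ‖x - x0‖ := by
      rw [hg, norm_smul, Real.norm_of_nonneg (by positivity)]
    rw [← hn] at hE
    have hS := hsub.2 x
    have hq := norm_nonneg (gradient φ x)
    have hqm : 0 ≤ ‖gradient φ x‖ ^ m := by positivity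
    have hin : -(‖b x‖ * ‖gradient φ x‖) ≤ ⟪b x, gradient φ x⟫ := by
      have := abs_real_inner_le_norm (b x) (gradient φ x)
      exact (abs_le.1 this).1
    have hY := young_est m mst (ρ + t) t ‖gradient φ x‖ hm hmst (by linarith) ht1 hq
    have hBq := mul_le_mul_of_nonneg_right hB hq
    have hk2 := mul_le_mul_of_nonneg_right hr2 hqm
    have e3 : (1 - (1 - t) ^ m) / m * ‖gradient φ x‖ ^ m =
      (1 / m) * ‖gradient φ x‖ ^ m - (1 - t) ^ m * ‖gradient φ x‖ ^ m / m := by ring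
    linarith
  have hlim : Tendsto (fun t : ℝ => t + ((ρ + t) / (1 - t)) ^ mst / mst + t) 
      (nhdsWithin 0 (Set.Ioi 0)) (nhds (ρ ^ mst / mst)) := by
    have : ContinuousAt (fun t : ℝ => t + ((ρ + t) / (1 - t)) ^ mst / mst + t) 0 := by
      apply ContinuousAt.add _ continuousAt_id
      apply continuousAt_id.add
      apply ContinuousAt.div_const
      apply ContinuousAt.rpow_const _ (Or.inr hmst0.le)
      apply ContinuousAt.div (by fun_prop) (by fun_prop) (by norm_num)
    have h := this.tendsto
    simp only [add_zero, sub_zero, div_one, zero_add] at h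
    exact h.mono_left nhdsWithin_le_nhds
  refine ge_of_tendsto hlim ?_
  filter_upwards [Ioo_mem_nhdsGT (show (0:ℝ) < 1 by norm_num)] with t ht
  exact key t ht.1 ht.2

theorem lower_bound {d : ℕ} (m ρ R mst : ℝ) (hm : 1 < m) (hρ : 0 < ρ) (hR : 0 < R)
    (hmst : mst = m / (m - 1)) (b : Euc d → Euc d) (V : Euc d → ℝ) (α : Euc d → ℝ)
    (hbc : Continuous b) (hVc : Continuous V) (hVp : ∀ x, 0 < V x)
    (hb : ∀ x : Euc d, R ≤ ‖x‖ → b x = ((ρ + α x) * ‖x‖ ^ ((0:ℝ) - 1)) • x)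
    (hα : Tendsto α (cocompact (Euc d)) (nhds 0)) (lam : ℝ) (hlam : lam < ρ ^ mst / mst) :
    ∃ β0 : ℝ, ∀ β ≥ β0, ∃ φ : Euc d → ℝ, IsSubsol m b V β lam φ := by
  have hm1 : m - 1 ≠ 0 := by linarith
  set k : ℝ := ρ ^ (mst - 1) with hk
  have hkp : 0 < k := rpow_pos_of_pos hρ _
  have hkρ : k * ρ = ρ ^ mst := by
    rw [hk, rpow_sub_one hρ.ne']; field_simp
  have hkm : k ^ m = ρ ^ mst := by
    rw [hk, ← rpow_mul hρ.le]
    congr 1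
    rw [hmst]; field_simp; ring
  have hlimv : -(k * ρ) + (1 / m) * k ^ m = -(ρ ^ mst / mst) := by
    rw [hkρ, hkm, hmst]; field_simp; ring
  set g : ℝ → ℝ := fun s => -k * √(1 + s) with hg
  set g1 : ℝ → ℝ := fun s => -(k / 2) * (√(1 + s))⁻¹ with hg1
  set g2 : ℝ → ℝ := fun s => k / (4 * √(1 + s) ^ 3) with hg2
  have hs : ∀ s : ℝ, -1 < s → HasDerivAt (fun s : ℝ => √(1 + s)) (1 / (2 * √(1 + s))) s := by
    intro s hs
    exact ((hasDerivAt_id s).const_add 1).sqrt (by simp only [id]; linarith)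
  have hsp : ∀ s : ℝ, -1 < s → 0 < √(1 + s) := fun s hs => Real.sqrt_pos.2 (by linarith)
  have hd1 : ∀ s : ℝ, -1 < s → HasDerivAt g (g1 s) s := by
    intro s h
    refine ((hs s h).const_mul (-k)).congr_deriv ?_
    simp only [hg1]
    have := hsp s h
    field_simp
  have hd2 : ∀ s : ℝ, -1 < s → HasDerivAt g1 (g2 s) s := by
    intro s h
    have := hsp s h
    refine (((hs s h).fun_inv this.ne').const_mul (-(k / 2))).congr_deriv ?_
    simp only [hg2]
    field_simp
    norm_num
  have hneg : ∀ x : Euc d, -1 < ‖x - 0‖ ^ 2 := fun x => by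
    have := sq_nonneg ‖x - 0‖
    linarith
  set φ : Euc d → ℝ := fun y => g (‖y - 0‖ ^ 2) with hφ
  have hgrad : ∀ x, gradient φ x = (2 * g1 (‖x - 0‖ ^ 2)) • (x - 0) := fun x =>
    radial_gradient 0 x g g1 (hd1 _ (hneg x))
  have hlap : ∀ x, lap φ x = 4 * g2 (‖x - 0‖ ^ 2) * ‖x - 0‖ ^ 2 + 2 * d * g1 (‖x - 0‖ ^ 2) :=
    fun x => radial_lap 0 x g g1 g2
      (by filter_upwards [lt_mem_nhds (hneg x)] with s hs using hd1 s hs) (hd2 _ (hneg x))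
  have hφc : ContDiff ℝ 3 φ := by
    apply contDiff_const.mul
    apply ContDiff.sqrt
    · exact contDiff_const.add ((contDiff_id.sub contDiff_const).norm_sq ℝ)
    · intro x; have := hneg x; exact (show (0:ℝ) < 1 + ‖x - 0‖ ^ 2 by linarith).ne'
  set F : Euc d → ℝ := fun x => - lap φ x + ⟪b x, gradient φ x⟫ + (1 / m) * ‖gradient φ x‖ ^ m with hF
  have hFc : Continuous F := by
    have hq : Continuous (fun x : Euc d => √(1 + ‖x - 0‖ ^ 2)) := by fun_prop
    have c1 : Continuous (fun x : Euc d => g1 (‖x - 0‖ ^ 2)) :=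
      continuous_const.mul (hq.inv₀ fun x => (hsp _ (hneg x)).ne')
    have c2 : Continuous (fun x : Euc d => g2 (‖x - 0‖ ^ 2)) :=
      continuous_const.div (continuous_const.mul (hq.pow 3)) fun x => by
        have := hsp _ (hneg x)
        positivity
    have c3 : Continuous (fun x => gradient φ x) := by
      simp only [hgrad]; exact (continuous_const.mul c1).smul (by fun_prop)
    have c4 : Continuous (fun x => lap φ x) := by
      simp only [hlap]
      exact ((continuous_const.mul c2).mul (by fun_prop)).add (continuous_const.mul c1)
    exact (c4.neg.add (hbc.inner c3)).add
      (continuous_const.mul (c3.norm.rpow_const fun x => Or.inr (by linarith)))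
  -- asymptotics
  set τ : Euc d → ℝ := fun x => ‖x‖ * (√(1 + ‖x‖ ^ 2))⁻¹ with hτ
  have hnt : Tendsto (fun x : Euc d => ‖x‖) (cocompact (Euc d)) atTop := tendsto_norm_cocompact_atTop
  have hqt : Tendsto (fun x : Euc d => √(1 + ‖x‖ ^ 2)) (cocompact (Euc d)) atTop := by
    refine tendsto_atTop_mono (fun x => ?_) hnt
    exact Real.le_sqrt_of_sq_le (by linarith)
  have hqi := hqt.inv_tendsto_atTop
  have hτt : Tendsto τ (cocompact (Euc d)) (nhds 1) := by
    have h1 : Tendsto (fun x : Euc d => √(1 - ((√(1 + ‖x‖ ^ 2))⁻¹) ^ 2)) (cocompact (Euc d)) (nhds (√(1 - 0 ^ 2))) :=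
      ((hqi.pow 2).const_sub 1).sqrt
    have h2 : √(1 - (0:ℝ) ^ 2) = 1 := by norm_num
    rw [h2] at h1
    refine h1.congr fun x => ?_
    have hp : 0 < 1 + ‖x‖ ^ 2 := by positivity
    have hsq := Real.sq_sqrt hp.le
    have hpp := Real.sqrt_pos.2 hp
    have hnn : 0 ≤ τ x := by positivity
    rw [← Real.sqrt_sq hnn]
    congr 1
    simp only [hτ, mul_pow, inv_pow, hsq]
    field_simp
    ring
  have hG : Tendsto (fun x => d * k * (√(1 + ‖x‖ ^ 2))⁻¹ + -(k * (ρ + α x) * τ x) + (1 / m) * (k * τ x) ^ m)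
      (cocompact (Euc d)) (nhds (d * k * 0 + -(k * (ρ + 0) * 1) + (1 / m) * (k * 1) ^ m)) := by
    refine ((hqi.const_mul _).add (((hα.const_add ρ).const_mul k).mul hτt).neg).add ?_
    exact ((hτt.const_mul k).rpow_const (Or.inr (by linarith))).const_mul _
  have hval : d * k * 0 + -(k * (ρ + 0) * 1) + (1 / m) * (k * 1) ^ m = -(ρ ^ mst / mst) := by
    rw [← hlimv]; ring_nf
  rw [hval] at hG
  have hev : ∀ᶠ x in cocompact (Euc d), lam + F x ≤ 0 := by
    filter_upwards [hG.eventually (gt_mem_nhds (show -(ρ ^ mst / mst) < -lam by linarith)),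
      hnt.eventually (eventually_ge_atTop R)] with x hx hxR
    have hxp : 0 < ‖x‖ := by linarith
    have hqp := hsp _ (hneg x)
    simp only [sub_zero] at hqp
    suffices h : F x ≤ d * k * (√(1 + ‖x‖ ^ 2))⁻¹ + -(k * (ρ + α x) * τ x) + (1 / m) * (k * τ x) ^ m by
      linarith
    have e1 : ‖gradient φ x‖ = k * τ x := by
      rw [hgrad, norm_smul]
      simp only [hg1, hτ, sub_zero]
      rw [Real.norm_eq_abs, show 2 * (-(k / 2) * (√(1 + ‖x‖ ^ 2))⁻¹) = -(k * (√(1 + ‖x‖ ^ 2))⁻¹) by ring,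
        abs_neg, abs_of_nonneg (by positivity)]
      ring
    have e2 : ⟪b x, gradient φ x⟫ = -(k * (ρ + α x) * τ x) := by
      rw [hgrad, hb x hxR, inner_smul_left, inner_smul_right]
      simp only [hg1, hτ, sub_zero, real_inner_self_eq_norm_sq, zero_sub, rpow_neg_one]
      simp
      field_simp
    have e3 : -lap φ x ≤ d * k * (√(1 + ‖x‖ ^ 2))⁻¹ := by
      rw [hlap]
      simp only [hg1, hg2, sub_zero]
      have : 0 ≤ 4 * (k / (4 * √(1 + ‖x‖ ^ 2) ^ 3)) * ‖x‖ ^ 2 := by positivity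
      linarith
    simp only [hF]
    rw [e1, e2]
    linarith
  obtain ⟨S, hS, hSs⟩ := mem_cocompact.1 hev
  obtain ⟨M, hM⟩ := hS.bddAbove_image (f := fun x => (lam + F x) / V x)
    ((continuous_const.add hFc).div hVc fun x => (hVp x).ne').continuousOn
  refine ⟨max M 0, fun β hβ => ⟨φ, hφc, fun x => ?_⟩⟩
  have goal : lam + F x ≤ β * V x := by
    by_cases hx : x ∈ S
    · have h1 : (lam + F x) / V x ≤ M := hM ⟨x, hx, rfl⟩
      rw [div_le_iff₀ (hVp x)] at h1
      have := mul_le_mul_of_nonneg_right ((le_max_left M 0).trans hβ) (hVp x).le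
      linarith
    · have h1 : lam + F x ≤ 0 := hSs hx
      have := mul_nonneg ((le_max_right M 0).trans hβ) (hVp x).le
      linarith
  simp only [hF] at goal
  linarith

/-- under (H1) with `δ = 0`, `λ_max(β) → ρ^{m*}/m*` as `β → ∞`. -/
theorem stmt11 (d : ℕ) (hd : 1 ≤ d) (m ρ R a η : ℝ) (hm : 1 < m)
    (hρ : 0 < ρ) (hη : 0 < η) (hR : 0 < R)
    (mst : ℝ) (hmst : mst = m / (m - 1))
    (b : Euc d → Euc d) (V : Euc d → ℝ) (α : Euc d → ℝ)
    (hH1 : HypH1 0 ρ R a η b V α) :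
    Tendsto (fun β : ℝ => lamMax m b V β) atTop (nhds (ρ ^ mst / mst)) := by
  obtain ⟨⟨hbC, hVC, -, -, hb, hα, hV0, hVs, hVt⟩, hext⟩ := hH1
  have hVp : ∀ x, 0 < V x := by
    intro x
    rcases le_total ‖x‖ R with h | h
    · have : x ∈ Function.support V := interior_subset (hVs (by simpa using h))
      exact lt_of_le_of_ne (hV0 x) (Ne.symm this)
    · rw [(hext x h).2]
      exact rpow_pos_of_pos (by linarith) _
  have hcob : ∀ p : Euc d → Prop, (∀ᶠ x in cocompact (Euc d), p x) →
      ∃ L : ℝ, ∀ x : Euc d, L ≤ ‖x‖ → p x := by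
    intro p hp
    obtain ⟨S, hS, hSs⟩ := mem_cocompact.1 hp
    obtain ⟨C, hC⟩ := hS.isBounded.exists_norm_le
    refine ⟨C + 1, fun x hx => hSs fun hxS => ?_⟩
    have := hC x hxS
    linarith
  have hup : ∀ β lam : ℝ, (∃ φ, IsSubsol m b V β lam φ) → lam ≤ ρ ^ mst / mst := by
    rintro β lam ⟨φ, hφ⟩
    refine upper_bound hd m ρ mst hm hρ hmst b V β lam φ hφ ?_ ?_
    · intro ε hε
      have h1 : Tendsto (fun x => |ρ + α x|) (cocompact (Euc d)) (nhds |ρ + 0|) :=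
        (hα.const_add ρ).abs
      rw [add_zero, abs_of_pos hρ] at h1
      apply hcob
      filter_upwards [h1.eventually (gt_mem_nhds (show ρ < ρ + ε by linarith)),
        (tendsto_norm_cocompact_atTop (E := Euc d)).eventually (eventually_ge_atTop R)] with x hx hxR
      have hxp : 0 < ‖x‖ := by linarith
      rw [hb x hxR, norm_smul, norm_mul, zero_sub, rpow_neg_one, norm_inv, norm_norm,
        Real.norm_eq_abs, mul_assoc, inv_mul_cancel₀ hxp.ne', mul_one]
      exact hx.le
    · intro ε hε
      have h1 := hVt.const_mul β
      rw [mul_zero] at h1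
      exact hcob _ (h1.eventually (ge_mem_nhds hε))
  have hbdd : ∀ β, BddAbove {lam : ℝ | ∃ φ : Euc d → ℝ, IsSubsol m b V β lam φ} :=
    fun β => ⟨_, fun lam h => hup β lam h⟩
  have hlow : ∀ lam : ℝ, lam < ρ ^ mst / mst → 
      ∀ᶠ β in atTop, lam ∈ {lam : ℝ | ∃ φ : Euc d → ℝ, IsSubsol m b V β lam φ} := by
    intro lam hlam
    obtain ⟨β0, h⟩ := lower_bound m ρ R mst hm hρ hR hmst b V α hbC.continuous hVC.continuous hVp
      hb hα lam hlam
    filter_upwards [eventually_ge_atTop β0] with β hβ using h β hβ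
  rw [tendsto_order]
  constructor
  · intro l hl
    obtain ⟨l', h1, h2⟩ := exists_between hl
    filter_upwards [hlow l' h2] with β hβ
    exact lt_of_lt_of_le h1 (le_csSup (hbdd β) hβ)
  · intro u hu
    filter_upwards [hlow _ (sub_one_lt (ρ ^ mst / mst))] with β hβ
    exact lt_of_le_of_lt (csSup_le ⟨_, hβ⟩ fun lam h => hup β lam h) hu

end
end

section
/- Let d ≥ 1, m > 1, m* = m/(m−1), and suppose (b,V) satisfies hypothesis (H1) with parameters δ = 0, ρ > 0, a ∈ ℝ, η > 0, R > 0. If 0 < η ≤ 1 or a ≥ d − 1, then there exists β₀ > 0 such that λ_max(β) = ρ^{m*}/m* for all β ≥ β₀. -/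
open Filter Real RealInnerProductSpace

noncomputable section

open Topology in
lemma sdt (g g' : ℝ → ℝ) (g'' : ℝ) (h1 : ∀ᶠ t in 𝓝 (0:ℝ), HasDerivAt g (g' t) t)
    (h2 : HasDerivAt g' g'' 0) (hmax : IsLocalMax g 0) : g'' ≤ 0 := by
  by_contra hpos
  push Not at hpos
  have hd : deriv g =ᶠ[𝓝 0] g' := h1.mono fun t ht => ht.deriv
  have hdd : deriv (deriv g) 0 = g'' := by
    rw [hd.deriv_eq]; exact h2.deriv
  have h0 : deriv g 0 = 0 := hmax.deriv_eq_zero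
  have hc : ContinuousAt g 0 := h1.self_of_nhds.continuousAt
  have hmin : IsLocalMin g 0 := isLocalMin_of_deriv_deriv_pos (by rw [hdd]; exact hpos) h0 hc
  have hconst : g =ᶠ[𝓝 0] fun _ => g 0 := by
    filter_upwards [hmin, hmax] with t ht1 ht2
    exact le_antisymm ht2 ht1
  have e1 : deriv g =ᶠ[𝓝 0] deriv (fun _ : ℝ => g 0) := hconst.deriv
  have e2 := e1.deriv_eq
  rw [hdd] at e2
  simp at e2
  linarith

lemma line1 {d : ℕ} (φ : Euc d → ℝ) (hφ : ContDiff ℝ 3 φ) (x e : Euc d) (t : ℝ) :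
    HasDerivAt (fun t : ℝ => φ (x + t • e)) (fderiv ℝ φ (x + t • e) e) t := by
  have h1 : HasFDerivAt φ (fderiv ℝ φ (x + t • e)) (x + t • e) :=
    (hφ.differentiable (by norm_num) _).hasFDerivAt
  have h2 : HasDerivAt (fun t : ℝ => x + t • e) e t := by
    simpa using ((hasDerivAt_id t).smul_const e).const_add x
  exact h1.comp_hasDerivAt t h2

lemma line2 {d : ℕ} (φ : Euc d → ℝ) (hφ : ContDiff ℝ 3 φ) (x e : Euc d) :
    HasDerivAt (fun t : ℝ => fderiv ℝ φ (x + t • e) e)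
      (fderiv ℝ (fun y => fderiv ℝ φ y e) x e) 0 := by
  have hF : ContDiff ℝ 2 (fun y => fderiv ℝ φ y e) :=
    (hφ.fderiv_right (m := 2) (by norm_num)).clm_apply contDiff_const
  have h1 : HasFDerivAt (fun y => fderiv ℝ φ y e) (fderiv ℝ (fun y => fderiv ℝ φ y e) x) (x + (0:ℝ) • e) := by
    simpa using (hF.differentiable (by norm_num) x).hasFDerivAt
  have h2 : HasDerivAt (fun t : ℝ => x + t • e) e 0 := by
    simpa using ((hasDerivAt_id (0:ℝ)).smul_const e).const_add x
  exact h1.comp_hasDerivAt 0 h2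

lemma exists_max {d : ℕ} (φ : Euc d → ℝ) (hφ : Continuous φ) (z : Euc d) (r k : ℝ)
    (hr : 0 < r) (hk : 1 ≤ k) : ∃ x0 : Euc d, ‖x0 - z‖ < r ∧
      ∀ x : Euc d, ‖x - z‖ < r →
      φ x - r * (1 - ‖x - z‖ ^ 2 / r ^ 2) ^ (-k) ≤ φ x0 - r * (1 - ‖x0 - z‖ ^ 2 / r ^ 2) ^ (-k) := by
  obtain ⟨M, hM⟩ := (isCompact_closedBall z r).bddAbove_image hφ.continuousOn
  have hM' : ∀ x, ‖x - z‖ ≤ r → φ x ≤ M := fun x hx =>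
    hM ⟨x, by simpa [dist_eq_norm] using hx, rfl⟩
  have hMz : φ z ≤ M := hM' z (by simpa using hr.le)
  set u0 : ℝ := r / (M - φ z + r + r) with hu0
  have hden : 0 < M - φ z + r + r := by linarith
  have hu0pos : 0 < u0 := by positivity
  have hu0lt : u0 < 1 := by rw [hu0, div_lt_one hden]; linarith
  set S : Set (Euc d) := {x | u0 ≤ 1 - ‖x - z‖ ^ 2 / r ^ 2} with hS
  have hSlt : ∀ x ∈ S, ‖x - z‖ < r := by
    intro x hx
    have h1 : ‖x - z‖ ^ 2 / r ^ 2 < 1 := by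
      have : u0 ≤ 1 - ‖x - z‖ ^ 2 / r ^ 2 := hx
      linarith
    rw [div_lt_one (by positivity)] at h1
    exact lt_of_pow_lt_pow_left₀ 2 hr.le h1
  have hScomp : IsCompact S := by
    refine (isCompact_closedBall z r).of_isClosed_subset ?_ ?_
    · exact isClosed_le continuous_const (by fun_prop)
    · intro x hx
      simpa [dist_eq_norm] using (hSlt x hx).le
  have hzS : z ∈ S := by simp [hS, hu0lt.le]
  have hcont : ContinuousOn (fun x => φ x - r * (1 - ‖x - z‖ ^ 2 / r ^ 2) ^ (-k)) S := by
    refine hφ.continuousOn.sub (continuousOn_const.mul ?_)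
    refine ContinuousOn.rpow_const (by fun_prop) ?_
    intro x hx
    left
    have : u0 ≤ 1 - ‖x - z‖ ^ 2 / r ^ 2 := hx
    linarith
  obtain ⟨x0, hx0, hmax⟩ := hScomp.exists_isMaxOn ⟨z, hzS⟩ hcont
  refine ⟨x0, hSlt x0 hx0, fun x hx => ?_⟩
  by_cases hxS : x ∈ S
  · exact hmax hxS
  · refine le_trans ?_ (hmax hzS)
    have hxu : 1 - ‖x - z‖ ^ 2 / r ^ 2 < u0 := not_le.mp hxS
    have hupos : 0 < 1 - ‖x - z‖ ^ 2 / r ^ 2 := by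
      have : ‖x - z‖ ^ 2 / r ^ 2 < 1 := by
        rw [div_lt_one (by positivity)]
        exact pow_lt_pow_left₀ hx (norm_nonneg _) (by norm_num)
      linarith
    set u := 1 - ‖x - z‖ ^ 2 / r ^ 2
    have h1 : u0⁻¹ ≤ u ^ (-k) := by
      calc u0⁻¹ ≤ u⁻¹ := by gcongr
        _ = u ^ (-1:ℝ) := (Real.rpow_neg_one u).symm
        _ ≤ u ^ (-k) := Real.rpow_le_rpow_of_exponent_ge hupos (by linarith) (by linarith)
    have h2 : r * u0⁻¹ = M - φ z + r + r := by
      rw [hu0]; field_simp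
    have h3 : r * u0⁻¹ ≤ r * u ^ (-k) := by gcongr
    have h4 := hM' x hx.le
    simp
    linarith

open Topology in
lemma lemA {d : ℕ} (φ : Euc d → ℝ) (hφ : ContDiff ℝ 3 φ) (z : Euc d) (r k : ℝ)
    (hr : 0 < r) (hk : 1 ≤ k) : ∃ x0 y : Euc d, ‖x0 - z‖ < r ∧ ‖y‖ < 1 ∧
      lap φ x0 ≤ (2 * k / r) * (d * (1 - ‖y‖ ^ 2) ^ (-k - 1)
        + 2 * (k + 1) * ‖y‖ ^ 2 * (1 - ‖y‖ ^ 2) ^ (-k - 2)) ∧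
      ‖gradient φ x0‖ = 2 * k * ‖y‖ * (1 - ‖y‖ ^ 2) ^ (-k - 1) := by
  obtain ⟨x0, hx0, hmax⟩ := exists_max φ hφ.continuous z r k hr hk
  have hyn : ‖r⁻¹ • (x0 - z)‖ = ‖x0 - z‖ / r := by
    rw [norm_smul, norm_inv, Real.norm_of_nonneg hr.le]; field_simp
  refine ⟨x0, r⁻¹ • (x0 - z), hx0, by rw [hyn, div_lt_one hr]; exact hx0, ?_⟩
  have hUeq : 1 - ‖r⁻¹ • (x0 - z)‖ ^ 2 = 1 - ‖x0 - z‖ ^ 2 / r ^ 2 := by rw [hyn, div_pow]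
  have hyi : ∀ i, (r⁻¹ • (x0 - z)) i = (x0 - z) i / r := by
    intro i; simp; field_simp
  have hysq : ‖r⁻¹ • (x0 - z)‖ ^ 2 = ∑ i, ((x0 - z) i / r) ^ 2 := by
    rw [EuclideanSpace.norm_sq_eq]; simp only [hyi, Real.norm_eq_abs, sq_abs]
  have hUpos : 0 < 1 - ‖x0 - z‖ ^ 2 / r ^ 2 := by
    have : ‖x0 - z‖ ^ 2 / r ^ 2 < 1 := by
      rw [div_lt_one (by positivity)]
      exact pow_lt_pow_left₀ hx0 (norm_nonneg _) (by norm_num)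
    linarith
  set U := 1 - ‖x0 - z‖ ^ 2 / r ^ 2 with hU
  have key : ∀ i : Fin d,
      fderiv ℝ φ x0 (EuclideanSpace.single i 1) = 2 * k / r * (x0 - z) i * U ^ (-k - 1) ∧
      fderiv ℝ (fun y => fderiv ℝ φ y (EuclideanSpace.single i 1)) x0 (EuclideanSpace.single i 1)
        ≤ 2 * k / r * (U ^ (-k - 1) + 2 * (k + 1) * ((x0 - z) i / r) ^ 2 * U ^ (-k - 2)) := by
    intro i
    set e : Euc d := EuclideanSpace.single i 1 with he
    set q := (x0 - z) i with hq
    have hnorm : ∀ t : ℝ, ‖x0 + t • e - z‖ ^ 2 = ‖x0 - z‖ ^ 2 + 2 * t * q + t ^ 2 := by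
      intro t
      have : x0 + t • e - z = (x0 - z) + t • e := by abel
      rw [this, norm_add_sq_real, inner_smul_right, norm_smul]
      simp [he, hq, EuclideanSpace.inner_single_right]
      ring
    set W : ℝ → ℝ := fun t => 1 - ‖x0 + t • e - z‖ ^ 2 / r ^ 2 with hW
    have hWf : W = fun t => 1 - (‖x0 - z‖ ^ 2 + 2 * t * q + t ^ 2) / r ^ 2 := by
      funext t; simp only [hW, hnorm]
    have hW0 : W 0 = U := by simp [hW, hU]
    have hWd : ∀ t, HasDerivAt W (-(2 * q + 2 * t) / r ^ 2) t := by
      intro t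
      rw [hWf]
      have := (((((hasDerivAt_id t).const_mul 2).mul_const q).const_add (‖x0 - z‖ ^ 2)).add
        ((hasDerivAt_id t).pow 2)).div_const (r ^ 2) |>.const_sub 1
      refine this.congr_deriv ?_
      simp; ring
    have hWpos : ∀ᶠ t in 𝓝 (0:ℝ), 0 < W t := by
      have := (hWd 0).continuousAt
      exact this.eventually (lt_mem_nhds (by rw [hW0]; exact hUpos))
    have hD1 : ∀ᶠ t in 𝓝 (0:ℝ), HasDerivAt (fun t => r * W t ^ (-k))
        (2 * k / r * ((q + t) * W t ^ (-k - 1))) t := by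
      filter_upwards [hWpos] with t ht
      have := ((hWd t).rpow_const (p := -k) (Or.inl ht.ne')).const_mul r
      refine this.congr_deriv ?_
      field_simp
    have hD2 : HasDerivAt (fun t => 2 * k / r * ((q + t) * W t ^ (-k - 1)))
        (2 * k / r * (U ^ (-k - 1) + 2 * (k + 1) * (q / r) ^ 2 * U ^ (-k - 2))) 0 := by
      have h1 := (hWd 0).rpow_const (p := -k - 1) (Or.inl (by rw [hW0]; exact hUpos.ne'))
      have := (((hasDerivAt_id (0:ℝ)).const_add q).mul h1).const_mul (2 * k / r)
      refine this.congr_deriv ?_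
      rw [hW0]
      have : (-k - 1 - 1 : ℝ) = -k - 2 := by ring
      rw [this]
      simp
      left
      field_simp
      ring
    have hG1 : ∀ᶠ t in 𝓝 (0:ℝ), HasDerivAt (fun t => φ (x0 + t • e) - r * W t ^ (-k))
        (fderiv ℝ φ (x0 + t • e) e - 2 * k / r * ((q + t) * W t ^ (-k - 1))) t := by
      filter_upwards [hD1] with t ht
      exact (line1 φ hφ x0 e t).sub ht
    have hG2 := (line2 φ hφ x0 e).sub hD2
    have hloc : IsLocalMax (fun t => φ (x0 + t • e) - r * W t ^ (-k)) 0 := by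
      have hc : ContinuousAt (fun t : ℝ => ‖x0 + t • e - z‖) 0 := by fun_prop
      have : ∀ᶠ t in 𝓝 (0:ℝ), ‖x0 + t • e - z‖ < r :=
        hc.eventually (gt_mem_nhds (by simpa using hx0))
      filter_upwards [this] with t ht
      have := hmax _ ht
      simpa [hW] using this
    constructor
    · have := hloc.hasDerivAt_eq_zero hG1.self_of_nhds
      rw [hW0] at this
      simp at this
      linarith
    · have := sdt _ _ _ hG1 hG2 hloc
      linarith
  rw [hUeq]
  constructor
  · unfold lap
    refine (Finset.sum_le_sum fun i _ => (key i).2).trans (le_of_eq ?_)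
    rw [← Finset.mul_sum, Finset.sum_add_distrib, ← Finset.sum_mul, ← Finset.mul_sum, ← hysq]
    simp
  · have hg : gradient φ x0 = (2 * k * U ^ (-k - 1)) • (r⁻¹ • (x0 - z)) := by
      ext i
      have h1 : (gradient φ x0) i = fderiv ℝ φ x0 (EuclideanSpace.single i 1) := by
        have h := inner_gradient_left (𝕜 := ℝ) (f := φ) (x := x0) (y := EuclideanSpace.single i 1)
        rw [← h, EuclideanSpace.inner_single_right]
        simp
      rw [h1, (key i).1, PiLp.smul_apply, hyi, smul_eq_mul]
      ring
    rw [hg, norm_smul, Real.norm_of_nonneg (by positivity)]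
    ring

lemma lemB (d : ℕ) (m : ℝ) (hm : 1 < m) : ∃ k K : ℝ, 1 ≤ k ∧ 0 < K ∧ ∀ s : ℝ, 0 ≤ s → s < 1 →
    2 * k * (d * (1 - s ^ 2) ^ (-k - 1) + 2 * (k + 1) * s ^ 2 * (1 - s ^ 2) ^ (-k - 2))
      ≤ K * (1 + (2 * k * s * (1 - s ^ 2) ^ (-k - 1)) ^ m) := by
  set k : ℝ := 1 + 1 / (m - 1) with hk
  have hm1 : 0 < m - 1 := by linarith
  have hk1 : 1 ≤ k := by have : 0 < 1 / (m - 1) := by positivity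
                         linarith
  have hkm : (-k - 1) * m ≤ -k - 2 := by
    have h : 1 / (m - 1) * (m - 1) = 1 := by field_simp
    have : (k + 1) * (m - 1) = 1 + 2 * (m - 1) := by
      rw [hk]; linear_combination h
    nlinarith
  set C : ℝ := 2 * k * (d + 2 * (k + 1)) with hC
  have hCpos : 0 < C := by positivity
  set D : ℝ := (1 / 2 : ℝ) ^ (-k - 2) with hD
  have hD1 : 1 ≤ D := Real.one_le_rpow_of_pos_of_le_one_of_nonpos (by norm_num) (by norm_num) (by linarith)
  refine ⟨k, C * D, hk1, by positivity, fun s hs0 hs1 => ?_⟩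
  have hs2 : s ^ 2 < 1 := by nlinarith
  set U := 1 - s ^ 2 with hU
  have hUpos : 0 < U := by linarith
  have hU1 : U ≤ 1 := by nlinarith [sq_nonneg s]
  have e1 : U ^ (-k - 1) ≤ U ^ (-k - 2) :=
    Real.rpow_le_rpow_of_exponent_ge hUpos hU1 (by linarith)
  have hP : 0 < U ^ (-k - 2) := Real.rpow_pos_of_pos hUpos _
  have hLHS : 2 * k * (d * U ^ (-k - 1) + 2 * (k + 1) * s ^ 2 * U ^ (-k - 2)) ≤ C * U ^ (-k - 2) := by
    have : d * U ^ (-k - 1) + 2 * (k + 1) * s ^ 2 * U ^ (-k - 2)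
        ≤ d * U ^ (-k - 2) + 2 * (k + 1) * 1 * U ^ (-k - 2) := by gcongr
    calc _ ≤ 2 * k * (d * U ^ (-k - 2) + 2 * (k + 1) * 1 * U ^ (-k - 2)) := by gcongr
      _ = _ := by rw [hC]; ring
  refine hLHS.trans ?_
  have hX : 0 ≤ (2 * k * s * U ^ (-k - 1)) ^ m := by positivity
  rw [mul_assoc C D]
  refine mul_le_mul_of_nonneg_left ?_ hCpos.le
  by_cases hs : 1 / 2 ≤ s
  · have h1 : U ^ (-k - 2) ≤ (2 * k * s * U ^ (-k - 1)) ^ m := by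
      calc U ^ (-k - 2) ≤ U ^ ((-k - 1) * m) := Real.rpow_le_rpow_of_exponent_ge hUpos hU1 hkm
        _ = (U ^ (-k - 1)) ^ m := Real.rpow_mul hUpos.le _ _
        _ ≤ _ := by
          refine Real.rpow_le_rpow (by positivity) ?_ (by linarith)
          refine le_mul_of_one_le_left (by positivity) ?_
          nlinarith
    nlinarith
  · push Not at hs
    have h1 : U ^ (-k - 2) ≤ D :=
      Real.rpow_le_rpow_of_nonpos (by norm_num) (by nlinarith) (by linarith)
    nlinarith

lemma far {d : ℕ} (f : Euc d → ℝ) (hf : Tendsto f (cocompact (Euc d)) (nhds 0)) (θ : ℝ) (hθ : 0 < θ) :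
    ∃ r : ℝ, 0 ≤ r ∧ ∀ x, r ≤ ‖x‖ → |f x| ≤ θ := by
  have h : ∀ᶠ x in cocompact (Euc d), |f x| < θ := by
    have := (hf.abs).eventually (gt_mem_nhds (by simpa using hθ))
    simpa using this
  rw [← Metric.cobounded_eq_cocompact, ← comap_norm_atTop, eventually_comap] at h
  obtain ⟨r, hr⟩ := eventually_atTop.mp h
  exact ⟨max r 0, le_max_right _ _, fun x hx => (hr ‖x‖ ((le_max_left _ _).trans hx) x rfl).le⟩

open Topology in
lemma upper (d : ℕ) (hd : 1 ≤ d) (m ρ R a η : ℝ) (hm : 1 < m)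
    (hρ : 0 < ρ) (hR : 0 < R)
    (mst : ℝ) (hmst : mst = m / (m - 1))
    (b : Euc d → Euc d) (V : Euc d → ℝ) (α : Euc d → ℝ)
    (hH1 : HypH1 0 ρ R a η b V α) (β : ℝ) (lam : ℝ) (φ : Euc d → ℝ)
    (h : IsSubsol m b V β lam φ) : lam ≤ ρ ^ mst / mst := by
  obtain ⟨⟨-, -, -, -, hb, hα, -, -, hV⟩, -⟩ := hH1
  obtain ⟨hφ, hsub⟩ := h
  by_contra hlt
  push Not at hlt
  have hm1 : 0 < m - 1 := by linarith
  have hconj : m.HolderConjugate mst := by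
    rw [hmst]; exact Real.HolderConjugate.conjExponent hm
  have hmst0 : 0 < mst := by rw [hmst]; positivity
  obtain ⟨k, K, hk, hK, hkK⟩ := lemB d m hm
  have hcont : ContinuousAt (fun θ : ℝ => ((ρ + θ) * (1 - m * θ) ^ (-(1 / m))) ^ mst / mst + 2 * θ) 0 := by
    have h1 : ContinuousAt (fun θ : ℝ => (1 - m * θ) ^ (-(1 / m))) 0 :=
      ContinuousAt.rpow_const (by fun_prop) (by simp)
    have h2 : ContinuousAt (fun θ : ℝ => ((ρ + θ) * (1 - m * θ) ^ (-(1 / m))) ^ mst) 0 :=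
      ContinuousAt.rpow_const (ContinuousAt.mul (by fun_prop) h1) (Or.inr hmst0.le)
    exact (h2.div_const _).add (by fun_prop)
  have hev : ∀ᶠ θ in 𝓝 (0:ℝ), ((ρ + θ) * (1 - m * θ) ^ (-(1 / m))) ^ mst / mst + 2 * θ < lam :=
    hcont.eventually (gt_mem_nhds (by simpa using hlt))
  have hev2 : ∀ᶠ θ in 𝓝 (0:ℝ), m * θ < 1 := by
    have : ContinuousAt (fun θ : ℝ => m * θ) 0 := by fun_prop
    exact this.eventually (gt_mem_nhds (by simp))
  obtain ⟨θ, ⟨hθ1, hθ2⟩, hθ0⟩ := (((hev.and hev2).filter_mono nhdsWithin_le_nhds).and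
    (self_mem_nhdsWithin (s := Set.Ioi (0:ℝ)))).exists
  have hθ0 : 0 < θ := hθ0
  obtain ⟨r1, hr1, hα1⟩ := far α hα θ hθ0
  obtain ⟨r2, hr2, hV1⟩ := far (fun x => β * V x) (by simpa using hV.const_mul β) θ hθ0
  set r := K / θ with hr
  have hrpos : 0 < r := by positivity
  set z : Euc d := EuclideanSpace.single ⟨0, hd⟩ (r1 + r2 + R + r) with hz
  have hzn : ‖z‖ = r1 + r2 + R + r := by
    rw [hz, EuclideanSpace.norm_single, Real.norm_of_nonneg (by positivity)]
  obtain ⟨x, y, hx, hy, hlap, hgrad⟩ := lemA φ hφ z r k hrpos hk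
  have hxn : r1 + r2 + R ≤ ‖x‖ := by
    have := norm_sub_norm_le z x
    rw [norm_sub_rev] at this
    linarith
  have hs := hsub x
  have hKK := hkK ‖y‖ (norm_nonneg _) hy
  rw [← hgrad] at hKK
  set t := ‖gradient φ x‖ with ht
  have ht0 : 0 ≤ t := norm_nonneg _
  have hlap2 : lap φ x ≤ θ * (1 + t ^ m) := by
    refine hlap.trans ?_
    have e1 : θ * (1 + t ^ m) = r⁻¹ * (K * (1 + t ^ m)) := by
      rw [hr]; field_simp
    rw [e1, show 2 * k / r = r⁻¹ * (2 * k) by field_simp, mul_assoc]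
    exact mul_le_mul_of_nonneg_left hKK (by positivity)
  have hbn : ‖b x‖ ≤ ρ + θ := by
    have hxpos : 0 < ‖x‖ := by linarith
    rw [hb x (by linarith), norm_smul, zero_sub, Real.rpow_neg_one, norm_mul, norm_inv, norm_norm,
      mul_assoc, inv_mul_cancel₀ hxpos.ne', mul_one, Real.norm_eq_abs]
    refine (abs_add_le _ _).trans ?_
    rw [abs_of_pos hρ]
    linarith [hα1 x (by linarith)]
  have hin : -((ρ + θ) * t) ≤ ⟪b x, gradient φ x⟫ := by
    have h1 := abs_real_inner_le_norm (b x) (gradient φ x)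
    have h2 : ‖b x‖ * ‖gradient φ x‖ ≤ (ρ + θ) * t := by gcongr
    have h3 := neg_abs_le ⟪b x, gradient φ x⟫
    linarith
  have hVx : β * V x ≤ θ := (le_abs_self _).trans (hV1 x (by linarith))
  have hw : 0 < 1 - m * θ := by linarith
  have hY := Real.young_inequality_of_nonneg (a := (1 - m * θ) ^ (1 / m) * t)
    (b := (ρ + θ) * (1 - m * θ) ^ (-(1 / m))) (by positivity) (by positivity) hconj
  have e2 : (1 - m * θ) ^ (1 / m) * t * ((ρ + θ) * (1 - m * θ) ^ (-(1 / m))) = (ρ + θ) * t := by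
    have : (1 - m * θ) ^ (1 / m) * (1 - m * θ) ^ (-(1 / m)) = 1 := by
      rw [← Real.rpow_add hw]; simp
    linear_combination (ρ + θ) * t * this
  have e3 : ((1 - m * θ) ^ (1 / m) * t) ^ m / m = 1 / m * t ^ m - θ * t ^ m := by
    rw [Real.mul_rpow (by positivity) ht0, ← Real.rpow_mul hw.le, one_div_mul_cancel (by linarith),
      Real.rpow_one]
    field_simp
  rw [e2, e3] at hY
  linarith

lemma lap_congr {d : ℕ} {f g : Euc d → ℝ} {x : Euc d} (h : f =ᶠ[nhds x] g) : lap f x = lap g x := by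
  unfold lap
  refine Finset.sum_congr rfl fun i _ => ?_
  have : (fun y => fderiv ℝ f y (EuclideanSpace.single i 1)) =ᶠ[nhds x]
      fun y => fderiv ℝ g y (EuclideanSpace.single i 1) := by
    filter_upwards [h.eventuallyEq_nhds] with y hy
    rw [hy.fderiv_eq]
  rw [this.fderiv_eq]

lemma fderiv_cnorm {d : ℕ} (c : ℝ) (x : Euc d) (hx : x ≠ 0) :
    HasFDerivAt (fun y : Euc d => c * ‖y‖) ((c * ‖x‖⁻¹) • innerSL ℝ x) x := by
  have h0 : 0 < ‖x‖ := norm_pos_iff.mpr hx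
  have h1 : HasFDerivAt (fun y : Euc d => ‖y‖ ^ 2) (2 • innerSL ℝ x) x :=
    (hasStrictFDerivAt_norm_sq x).hasFDerivAt
  have h2 := (h1.sqrt (by positivity)).const_mul c
  simp only [Real.sqrt_sq (norm_nonneg _)] at h2
  refine h2.congr_fderiv ?_
  ext v
  simp
  field_simp

lemma grad_cnorm {d : ℕ} (c : ℝ) (x : Euc d) (hx : x ≠ 0) :
    gradient (fun y : Euc d => c * ‖y‖) x = (c * ‖x‖⁻¹) • x := by
  apply HasGradientAt.gradient
  rw [hasGradientAt_iff_hasFDerivAt]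
  refine (fderiv_cnorm c x hx).congr_fderiv ?_
  ext v
  simp [inner_smul_left]

lemma lap_cnorm {d : ℕ} (c : ℝ) (x : Euc d) (hx : x ≠ 0) :
    lap (fun y : Euc d => c * ‖y‖) x = c * (d - 1) * ‖x‖⁻¹ := by
  have h0 : 0 < ‖x‖ := norm_pos_iff.mpr hx
  unfold lap
  have key : ∀ i : Fin d, fderiv ℝ (fun y => fderiv ℝ (fun y : Euc d => c * ‖y‖) y
      (EuclideanSpace.single i 1)) x (EuclideanSpace.single i 1)
      = c * ‖x‖⁻¹ - c * ‖x‖⁻¹ ^ 3 * (x i) ^ 2 := by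
    intro i
    have h1 : (fun y => fderiv ℝ (fun y : Euc d => c * ‖y‖) y (EuclideanSpace.single i 1))
        =ᶠ[nhds x] fun y => c * (y i * (1 * ‖y‖)⁻¹) := by
      filter_upwards [isOpen_ne.mem_nhds hx] with y hy
      rw [(fderiv_cnorm c y hy).fderiv]
      simp [EuclideanSpace.inner_single_right]
      ring
    rw [h1.fderiv_eq]
    have hp : HasFDerivAt (fun y : Euc d => y i) (EuclideanSpace.proj (𝕜 := ℝ) i) x :=
      (EuclideanSpace.proj (𝕜 := ℝ) i).hasFDerivAt
    have hn := fderiv_cnorm 1 x hx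
    have hi : HasFDerivAt (fun y : Euc d => (1 * ‖y‖)⁻¹)
        ((-((1 * ‖x‖) ^ 2)⁻¹) • ((1 * ‖x‖⁻¹) • innerSL ℝ x)) x :=
      (hasDerivAt_inv (by simpa using hx)).comp_hasFDerivAt x hn
    have hall : HasFDerivAt (fun y : Euc d => c * (y i * (1 * ‖y‖)⁻¹)) _ x := (hp.mul hi).const_mul c
    rw [hall.fderiv]
    simp [EuclideanSpace.inner_single_right]
    field_simp
    ring
  simp only [key]
  have hs : ∑ i, (x i) ^ 2 = ‖x‖ ^ 2 := by
    rw [EuclideanSpace.norm_sq_eq]; simp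
  rw [Finset.sum_sub_distrib, ← Finset.mul_sum, ← Finset.mul_sum, hs]
  simp
  field_simp

lemma exists_phi (d : ℕ) (R c : ℝ) (hR : 0 < R) : ∃ φ : Euc d → ℝ, ContDiff ℝ 3 φ ∧
    ∀ x, R ≤ ‖x‖ → φ =ᶠ[nhds x] fun y => c * ‖y‖ := by
  let χ : ContDiffBump (0 : Euc d) := ⟨R / 4, R / 2, by positivity, by linarith⟩
  refine ⟨fun x => c * ((1 - χ x) * ‖x‖), ?_, ?_⟩
  · rw [contDiff_iff_contDiffAt]
    intro x
    by_cases hx : x = 0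
    · have : (fun x => c * ((1 - χ x) * ‖x‖)) =ᶠ[nhds x] fun _ => 0 := by
        rw [hx]
        filter_upwards [χ.eventuallyEq_one] with y hy
        simp [hy]
      exact contDiffAt_const.congr_of_eventuallyEq this
    · exact contDiffAt_const.mul ((contDiffAt_const.sub χ.contDiffAt).mul (contDiffAt_norm ℝ hx))
  · intro x hx
    have : {y : Euc d | R / 2 < ‖y‖} ∈ nhds x :=
      (isOpen_lt continuous_const continuous_norm).mem_nhds (by simp; linarith)
    filter_upwards [this] with y hy
    have : χ y = 0 := χ.zero_of_le_dist (by simpa [χ] using le_of_lt hy)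
    simp [this]

lemma lower (d : ℕ) (m ρ R a η : ℝ) (hm : 1 < m)
    (hρ : 0 < ρ) (hR : 0 < R)
    (mst : ℝ) (hmst : mst = m / (m - 1))
    (b : Euc d → Euc d) (V : Euc d → ℝ) (α : Euc d → ℝ)
    (hH1 : HypH1 0 ρ R a η b V α)
    (hcase : η ≤ 1 ∨ (d : ℝ) - 1 ≤ a) :
    ∃ β₀ : ℝ, 0 < β₀ ∧ ∀ β : ℝ, β₀ ≤ β → ∃ φ, IsSubsol m b V β (ρ ^ mst / mst) φ := by
  obtain ⟨⟨hbc, hVc, -, -, hb, -, hV0, hsupp, -⟩, hout⟩ := hH1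
  have hm1 : 0 < m - 1 := by linarith
  set c : ℝ := ρ ^ (mst - 1) with hc
  have hcpos : 0 < c := Real.rpow_pos_of_pos hρ _
  obtain ⟨φ, hφ, hφout⟩ := exists_phi d R (-c) hR
  set F : Euc d → ℝ := fun x => ρ ^ mst / mst - lap φ x + ⟪b x, gradient φ x⟫
    + (1 / m) * ‖gradient φ x‖ ^ m with hF
  have hgc : Continuous (gradient φ) := by
    have h1 : Continuous (fderiv ℝ φ) := hφ.continuous_fderiv (by norm_num)
    exact (InnerProductSpace.toDual ℝ (Euc d)).symm.continuous.comp h1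
  have hlc : Continuous (lap φ) := by
    unfold lap
    refine continuous_finset_sum _ fun i _ => ?_
    have h1 : ContDiff ℝ 2 (fun y => fderiv ℝ φ y (EuclideanSpace.single i 1)) :=
      (hφ.fderiv_right (m := 2) (by norm_num)).clm_apply contDiff_const
    exact (h1.continuous_fderiv (by norm_num)).clm_apply continuous_const
  have hFc : Continuous F := by
    refine ((continuous_const.sub hlc).add (hbc.continuous.inner hgc)).add
      (continuous_const.mul (hgc.norm.rpow_const fun x => Or.inr (by linarith)))
  have hcomp := isCompact_closedBall (0 : Euc d) R
  obtain ⟨M, hM⟩ := hcomp.bddAbove_image hFc.continuousOn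
  obtain ⟨x1, hx1, hmin⟩ := hcomp.exists_isMinOn ⟨0, by simp [hR.le]⟩ hVc.continuous.continuousOn
  have hv0 : 0 < V x1 :=
    lt_of_le_of_ne (hV0 x1) (Ne.symm (interior_subset (hsupp hx1)))
  refine ⟨1 + |M| / V x1 + c * |d - 1 - a| * R ^ (η - 1), by positivity, fun β hβ => ⟨φ, hφ, fun x => ?_⟩⟩
  have hA : 0 ≤ |M| / V x1 := by positivity
  have hB : 0 ≤ c * |d - 1 - a| * R ^ (η - 1) := by positivity
  have hβ0 : 0 ≤ β := by linarith
  suffices F x ≤ β * V x by linarith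
  by_cases hx : ‖x‖ ≤ R
  · have hxm : x ∈ Metric.closedBall (0 : Euc d) R := by simpa using hx
    have h1 : F x ≤ M := hM ⟨x, hxm, rfl⟩
    have h2 : V x1 ≤ V x := hmin hxm
    calc F x ≤ |M| := h1.trans (le_abs_self _)
      _ = |M| / V x1 * V x1 := by field_simp
      _ ≤ β * V x := by gcongr; linarith
  · push Not at hx
    have hx0 : 0 < ‖x‖ := by linarith
    have hxne : x ≠ 0 := norm_pos_iff.mp hx0
    have e := hφout x hx.le
    obtain ⟨hα, hVx⟩ := hout x hx.le
    have hg : gradient φ x = (-c * ‖x‖⁻¹) • x := by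
      rw [← grad_cnorm (-c) x hxne]
      unfold gradient; rw [e.fderiv_eq]
    have hgn : ‖gradient φ x‖ = c := by
      rw [hg, norm_smul, norm_mul, norm_neg, norm_inv, norm_norm, Real.norm_of_nonneg hcpos.le]
      field_simp
    have hin : ⟪b x, gradient φ x⟫ = -c * (ρ + a * ‖x‖⁻¹) := by
      rw [hg, hb x hx.le, hα, zero_sub, Real.rpow_neg_one, inner_smul_left, inner_smul_right,
        real_inner_self_eq_norm_sq]
      simp
      field_simp
    have hcm : c ^ m = ρ ^ mst := by
      rw [hc, ← Real.rpow_mul hρ.le]; congr 1; rw [hmst]; field_simp; ring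
    have hcρ : c * ρ = ρ ^ mst := by
      rw [hc, Real.rpow_sub_one hρ.ne']; field_simp
    have hmm : 1 / mst = 1 - 1 / m := by rw [hmst]; field_simp
    have hFx : F x = c * (d - 1 - a) * ‖x‖⁻¹ := by
      simp only [hF]
      rw [lap_congr e, lap_cnorm _ x hxne, hgn, hin, hcm]
      have : ρ ^ mst / mst = ρ ^ mst * (1 - 1 / m) := by rw [← hmm]; ring
      rw [this]
      linear_combination -hcρ
    rw [hFx, hVx]
    rcases hcase with h | h
    · have h1 : ‖x‖⁻¹ ≤ R ^ (η - 1) * ‖x‖ ^ (-η) := by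
        have : ‖x‖⁻¹ = ‖x‖ ^ (η - 1) * ‖x‖ ^ (-η) := by
          rw [← Real.rpow_add hx0, ← Real.rpow_neg_one]; congr 1; ring
        rw [this]
        gcongr ?_ * _
        exact Real.rpow_le_rpow_of_nonpos hR hx.le (by linarith)
      calc c * (d - 1 - a) * ‖x‖⁻¹ ≤ c * |d - 1 - a| * ‖x‖⁻¹ := by
            gcongr; exact le_abs_self _
        _ ≤ c * |d - 1 - a| * (R ^ (η - 1) * ‖x‖ ^ (-η)) := by gcongr
        _ = c * |d - 1 - a| * R ^ (η - 1) * ‖x‖ ^ (-η) := by ring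
        _ ≤ β * ‖x‖ ^ (-η) := by gcongr; linarith
    · have h1 : c * (d - 1 - a) * ‖x‖⁻¹ ≤ 0 :=
        mul_nonpos_of_nonpos_of_nonneg (mul_nonpos_of_nonneg_of_nonpos hcpos.le (by linarith)) (by positivity)
      exact h1.trans (by positivity)


/-- if `0 < η ≤ 1` or `a ≥ d - 1`, the plateau occurs. -/
theorem stmt12 (d : ℕ) (hd : 1 ≤ d) (m ρ R a η : ℝ) (hm : 1 < m)
    (hρ : 0 < ρ) (hη : 0 < η) (hR : 0 < R)
    (mst : ℝ) (hmst : mst = m / (m - 1))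
    (b : Euc d → Euc d) (V : Euc d → ℝ) (α : Euc d → ℝ)
    (hH1 : HypH1 0 ρ R a η b V α)
    (hcase : η ≤ 1 ∨ (d : ℝ) - 1 ≤ a) :
    ∃ β₀ : ℝ, 0 < β₀ ∧ ∀ β : ℝ, β₀ ≤ β → lamMax m b V β = ρ ^ mst / mst := by
  obtain ⟨β₀, hβ₀, h⟩ := lower d m ρ R a η hm hρ hR mst hmst b V α hH1 hcase
  refine ⟨β₀, hβ₀, fun β hβ => ?_⟩
  refine IsGreatest.csSup_eq ⟨h β hβ, ?_⟩
  rintro lam ⟨φ, hφ⟩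
  exact upper d hd m ρ R a η hm hρ hR mst hmst b V α hH1 β lam φ hφ

end
end

section
/- Let d ≥ 1, m > 1, m* = m/(m−1), and suppose (b,V) satisfies hypothesis (H0) with parameter δ = 0 and constants ρ > 0, R > 0. Assume moreover that α(x) = a|x|^{−1} for all x ∉ B_R for some a ∈ ℝ, and that the support of V is contained in B_{R'} for some R' > R. If a ≥ d − 1, then lim_{β→∞} λ_max(β) = ρ^{m*}/m* and there exists β₀ > 0 such that λ_max(β) = ρ^{m*}/m* for all β ≥ β₀. -/
open Filter Real RealInnerProductSpace

noncomputable section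

/-- moderate drift, compactly supported potential, `a ≥ d - 1`: the plateau
occurs at level `ρ^{m*}/m*`. -/

theorem aux_second_deriv {u u' : ℝ → ℝ} {u'' : ℝ} (hu : ∀ᶠ t in nhds (0:ℝ), HasDerivAt u (u' t) t)
    (hu' : HasDerivAt u' u'' 0) (hmax : IsLocalMax u 0) : u' 0 = 0 ∧ u'' ≤ 0 := by
  have h0 : u' 0 = 0 := hmax.hasDerivAt_eq_zero hu.self_of_nhds
  refine ⟨h0, ?_⟩
  by_contra! hpos
  have hd : deriv u =ᶠ[nhds 0] u' := by
    filter_upwards [hu] with t ht using ht.deriv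
  have hdd : deriv (deriv u) 0 = u'' := by rw [hd.deriv_eq]; exact hu'.deriv
  have hmin : IsLocalMin u 0 := by
    apply isLocalMin_of_deriv_deriv_pos
    · rw [hdd]; exact hpos
    · rw [hd.self_of_nhds, h0]
    · exact hu.self_of_nhds.continuousAt
  have hc : u =ᶠ[nhds 0] fun _ => u 0 := by
    filter_upwards [hmax, hmin] with t h1 h2 using le_antisymm h1 h2
  have h2 : deriv u =ᶠ[nhds 0] fun _ => (0:ℝ) := by
    have := hc.deriv
    simpa using this
  have : deriv (deriv u) 0 = 0 := by rw [h2.deriv_eq]; simp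
  linarith

theorem aux_line1 {d : ℕ} {φ : Euc d → ℝ} (h : ContDiff ℝ 3 φ) (x v : Euc d) (t : ℝ) :
    HasDerivAt (fun t : ℝ => φ (x + t • v)) (fderiv ℝ φ (x + t • v) v) t := by
  have h1 : HasDerivAt (fun t : ℝ => x + t • v) v t := by
    simpa using ((hasDerivAt_id t).smul_const v).const_add x
  exact ((h.differentiable (by norm_num)) (x + t • v)).hasFDerivAt.comp_hasDerivAt t h1

theorem aux_line2 {d : ℕ} {φ : Euc d → ℝ} (h : ContDiff ℝ 3 φ) (x v : Euc d) :
    HasDerivAt (fun t : ℝ => fderiv ℝ φ (x + t • v) v)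
      (fderiv ℝ (fun y => fderiv ℝ φ y v) x v) 0 := by
  have h1 : HasDerivAt (fun t : ℝ => x + t • v) v 0 := by
    simpa using ((hasDerivAt_id (0:ℝ)).smul_const v).const_add x
  have h2 : ContDiff ℝ 2 (fun y => fderiv ℝ φ y v) :=
    (h.fderiv_right (m := 2) (by norm_num)).clm_apply contDiff_const
  have h3 := ((h2.differentiable (by norm_num)) x).hasFDerivAt
  have h4 : x = x + (0:ℝ) • v := by simp
  rw [h4] at h3
  have := h3.comp_hasDerivAt (0:ℝ) h1
  simpa [Function.comp_def] using this

theorem aux_grad {d : ℕ} {φ : Euc d → ℝ} (h : ContDiff ℝ 3 φ) (x : Euc d) (i : Fin d) :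
    gradient φ x i = fderiv ℝ φ x (EuclideanSpace.single i 1) := by
  have h1 := ((h.differentiable (by norm_num)) x).hasGradientAt
  have := h1.hasFDerivAt.fderiv
  have h2 : fderiv ℝ φ x (EuclideanSpace.single i 1) =
      ⟪gradient φ x, EuclideanSpace.single i (1:ℝ)⟫ := by
    rw [this, InnerProductSpace.toDual_apply_apply]
  rw [h2, EuclideanSpace.inner_single_right]
  simp

theorem aux_normsq {d : ℕ} (z : Euc d) (i : Fin d) (t : ℝ) :
    ‖z + t • EuclideanSpace.single i (1:ℝ)‖ ^ 2 = ‖z‖ ^ 2 + (2 * t * z i + t ^ 2) := by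
  rw [norm_add_sq_real, inner_smul_right, EuclideanSpace.inner_single_right, norm_smul]
  simp
  ring

theorem aux_contlap {d : ℕ} {φ : Euc d → ℝ} (h : ContDiff ℝ 3 φ) : Continuous (lap φ) := by
  unfold lap
  refine continuous_finsetSum _ fun i _ => ?_
  have h2 : ContDiff ℝ 2 (fun y => fderiv ℝ φ y (EuclideanSpace.single i (1:ℝ))) :=
    (h.fderiv_right (m := 2) (by norm_num)).clm_apply contDiff_const
  exact (h2.continuous_fderiv (by norm_num)).clm_apply continuous_const

theorem aux_contgrad {d : ℕ} {φ : Euc d → ℝ} (h : ContDiff ℝ 3 φ) : Continuous (gradient φ) := by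
  unfold gradient
  exact (LinearIsometryEquiv.continuous _).comp (h.continuous_fderiv (by norm_num))

/-- the comparison profile in one dimension -/
theorem aux_barrier_deriv (A L γ s0 z t : ℝ) (hs : s0 - (2 * t * z + t ^ 2) / L ^ 2 ≠ 0) :
    HasDerivAt (fun t : ℝ => A * (s0 - (2 * t * z + t ^ 2) / L ^ 2) ^ (-γ))
      (A * γ * (s0 - (2 * t * z + t ^ 2) / L ^ 2) ^ (-γ - 1) * ((2 * z + 2 * t) / L ^ 2)) t := by
  have h1 : HasDerivAt (fun t : ℝ => s0 - (2 * t * z + t ^ 2) / L ^ 2)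
      (-((2 * z + 2 * t) / L ^ 2)) t := by
    have := ((((hasDerivAt_id t).const_mul 2).mul_const z).add (hasDerivAt_pow 2 t)).div_const (L ^ 2)
    have := this.const_sub s0
    refine this.congr_deriv ?_
    simp
  have := (h1.rpow_const (p := -γ) (Or.inl hs)).const_mul A
  refine this.congr_deriv ?_
  ring

theorem aux_barrier_deriv2 (A L γ s0 z : ℝ) (hs : s0 ≠ 0) :
    HasDerivAt (fun t : ℝ => A * γ * (s0 - (2 * t * z + t ^ 2) / L ^ 2) ^ (-γ - 1) *
        ((2 * z + 2 * t) / L ^ 2))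
      (A * γ * (γ + 1) * s0 ^ (-γ - 2) * (2 * z / L ^ 2) ^ 2 + A * γ * s0 ^ (-γ - 1) * (2 / L ^ 2))
      0 := by
  have h1 := aux_barrier_deriv (A * γ) L (γ + 1) s0 z 0 (by simpa using hs)
  have h2 : HasDerivAt (fun t : ℝ => (2 * z + 2 * t) / L ^ 2) (2 / L ^ 2) 0 := by
    have := (((hasDerivAt_id (0:ℝ)).const_mul 2).const_add (2 * z)).div_const (L ^ 2)
    simpa using this
  have := h1.mul h2
  have e1 : -(γ + 1) = -γ - 1 := by ring
  have e2 : -γ - 1 - 1 = -γ - 2 := by ring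
  rw [e1, e2] at this
  refine this.congr_deriv ?_
  simp
  ring

theorem aux_norm_deriv (c r2 z t : ℝ) (hs : r2 + (2 * t * z + t ^ 2) ≠ 0) :
    HasDerivAt (fun t : ℝ => -c * √(r2 + (2 * t * z + t ^ 2)))
      (-c * ((z + t) / √(r2 + (2 * t * z + t ^ 2)))) t := by
  have h1 : HasDerivAt (fun t : ℝ => r2 + (2 * t * z + t ^ 2)) (2 * z + 2 * t) t := by
    have := (((((hasDerivAt_id t).const_mul 2).mul_const z).add (hasDerivAt_pow 2 t))).const_add r2
    refine this.congr_deriv ?_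
    simp
  have := (h1.sqrt hs).const_mul (-c)
  refine this.congr_deriv ?_
  rw [← mul_add, mul_div_mul_left _ _ two_ne_zero]

theorem aux_norm_deriv2 (c r z : ℝ) (hr : 0 < r) :
    HasDerivAt (fun t : ℝ => -c * ((z + t) / √(r ^ 2 + (2 * t * z + t ^ 2))))
      (-c * (1 / r - z ^ 2 / r ^ 3)) 0 := by
  have h1 := aux_norm_deriv (-1) (r ^ 2) z 0 (by simp; positivity)
  have h2 := (hasDerivAt_id (0:ℝ)).const_add z
  have h3 := (h2.div h1 (by simp; rw [Real.sqrt_sq hr.le]; exact hr.ne')).const_mul (-c)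
  simp [Real.sqrt_sq hr.le] at h3
  have h4 : (fun t : ℝ => -c * ((z + t) / √(r ^ 2 + (2 * t * z + t ^ 2)))) =
      fun t => -(c * ((z + t) / √(r ^ 2 + (2 * t * z + t ^ 2)))) := by
    ext t; ring
  rw [h4]
  refine h3.congr_deriv ?_
  field_simp

theorem aux_alg (m ε θ D : ℝ) (hm : 1 < m) (hε : 0 < ε) (hθ : 0 < θ) (hD : 0 ≤ D) :
    ∃ L γ : ℝ, 0 < L ∧ 0 < γ ∧ ∀ t : ℝ, 0 ≤ t → t < 1 →
      (2 * γ / L) * D * (1 - t ^ 2) ^ (-γ - 1) +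
        (4 * γ * (γ + 1) / L) * t ^ 2 * (1 - t ^ 2) ^ (-γ - 2) <
      ε + θ * (2 * γ * t * (1 - t ^ 2) ^ (-γ - 1)) ^ m := by
  set γ : ℝ := 1 / (m - 1) with hγdef
  have hm1 : 0 < m - 1 := by linarith
  have hγ : 0 < γ := by positivity
  set C : ℝ := 2 * γ * D + 4 * γ * (γ + 1) with hC
  have hCpos : 0 < C := by positivity
  set E : ℝ := (3 / 4 : ℝ) ^ (-γ - 2) with hE
  have hEpos : 0 < E := by positivity
  set L : ℝ := C * E / ε + C / (θ * γ ^ m) + 1 with hL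
  have hgm : 0 < γ ^ m := by positivity
  have hLpos : 0 < L := by positivity
  have hL1 : C * E / L < ε := by
    rw [div_lt_iff₀ hLpos]
    have : C * E / ε < L := by
      have : 0 < C / (θ * γ ^ m) := by positivity
      linarith
    rw [div_lt_iff₀ hε] at this
    linarith
  have hL2 : C / L < θ * γ ^ m := by
    rw [div_lt_iff₀ hLpos]
    have : C / (θ * γ ^ m) < L := by
      have : 0 < C * E / ε := by positivity
      linarith
    rw [div_lt_iff₀ (by positivity)] at this
    linarith
  refine ⟨L, γ, hLpos, hγ, fun t ht0 ht1 => ?_⟩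
  set s : ℝ := 1 - t ^ 2 with hs
  have hspos : 0 < s := by nlinarith
  have hs1 : s ≤ 1 := by nlinarith [sq_nonneg t]
  have ht2 : t ^ 2 ≤ 1 := by nlinarith
  have hmono : s ^ (-γ - 1) ≤ s ^ (-γ - 2) :=
    Real.rpow_le_rpow_of_exponent_ge hspos hs1 (by linarith)
  have hS : 0 < s ^ (-γ - 2) := by positivity
  have hlhs : (2 * γ / L) * D * s ^ (-γ - 1) +
        (4 * γ * (γ + 1) / L) * t ^ 2 * s ^ (-γ - 2) ≤ C / L * s ^ (-γ - 2) := by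
    have h1 : (2 * γ / L) * D * s ^ (-γ - 1) ≤ (2 * γ / L) * D * s ^ (-γ - 2) := by gcongr
    have h2 : (4 * γ * (γ + 1) / L) * t ^ 2 * s ^ (-γ - 2) ≤
        (4 * γ * (γ + 1) / L) * 1 * s ^ (-γ - 2) := by gcongr
    have h3 : C / L * s ^ (-γ - 2) =
      (2 * γ / L) * D * s ^ (-γ - 2) + (4 * γ * (γ + 1) / L) * 1 * s ^ (-γ - 2) := by
      rw [hC]; ring
    linarith
  rcases lt_or_ge t (1/2) with h | h
  · have h34 : 3 / 4 ≤ s := by nlinarith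
    have h1 : s ^ (-γ - 2) ≤ E :=
      Real.rpow_le_rpow_of_nonpos (by norm_num) h34 (by linarith)
    have h2 : C / L * s ^ (-γ - 2) ≤ C / L * E := by gcongr
    have h3 : C / L * E = C * E / L := by ring
    have h4 : 0 ≤ θ * (2 * γ * t * s ^ (-γ - 1)) ^ m := by positivity
    linarith
  · have h1 : (γ * s ^ (-γ - 1)) ^ m ≤ (2 * γ * t * s ^ (-γ - 1)) ^ m := by
      apply Real.rpow_le_rpow (by positivity) _ (by linarith)
      have : γ ≤ 2 * γ * t := by nlinarith
      gcongr
    have h2 : (γ * s ^ (-γ - 1)) ^ m = γ ^ m * s ^ ((-γ - 1) * m) := by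
      rw [Real.mul_rpow hγ.le (by positivity), ← Real.rpow_mul hspos.le]
    have h3 : s ^ (-γ - 2) ≤ s ^ ((-γ - 1) * m) := by
      apply Real.rpow_le_rpow_of_exponent_ge hspos hs1
      have : γ * (m - 1) = 1 := by rw [hγdef]; field_simp
      nlinarith
    have h4 : C / L * s ^ (-γ - 2) < θ * γ ^ m * s ^ (-γ - 2) := by gcongr
    have h5 : θ * γ ^ m * s ^ (-γ - 2) ≤ θ * (2 * γ * t * s ^ (-γ - 1)) ^ m := by
      rw [mul_assoc]
      gcongr
      refine le_trans ?_ h1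
      rw [h2]
      gcongr
    linarith

theorem aux_no {d : ℕ} (m ε θ : ℝ) (hm : 1 < m) (hε : 0 < ε) (hθ : 0 < θ) :
    ∃ L : ℝ, 0 < L ∧ ∀ (x0 : Euc d) (φ : Euc d → ℝ), ContDiff ℝ 3 φ →
      ¬ (∀ x, ‖x - x0‖ < L → ε + θ * ‖gradient φ x‖ ^ m ≤ lap φ x) := by
  obtain ⟨L, γ, hL, hγ, halg⟩ := aux_alg m ε θ d hm hε hθ (by positivity)
  refine ⟨L, hL, fun x0 φ hφ hsub => ?_⟩
  -- compactness
  obtain ⟨M, hM⟩ := ((isCompact_closedBall x0 L).image hφ.continuous).bddAbove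
  have hM' : ∀ x, ‖x - x0‖ ≤ L → φ x ≤ M := fun x hx =>
    hM ⟨x, by simpa [dist_eq_norm] using hx, rfl⟩
  have hlim : Tendsto (fun σ : ℝ => σ ^ (-γ)) (nhdsWithin 0 (Set.Ioi 0)) atTop :=
    tendsto_rpow_neg_nhdsGT_zero (by linarith)
  have hev := (hlim.eventually_gt_atTop ((M - φ x0 + L) / L)).and
    (Ioo_mem_nhdsGT (zero_lt_one (α := ℝ)))
  obtain ⟨σ, hσ, hσ0, hσ1⟩ := hev.exists
  rw [div_lt_iff₀ hL] at hσ
  set S : Euc d → ℝ := fun x => 1 - ‖x - x0‖ ^ 2 / L ^ 2 with hS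
  have hScont : Continuous S := by fun_prop
  set K : Set (Euc d) := {x | σ ≤ S x} with hK
  have hnorm : ∀ x, 0 < S x → ‖x - x0‖ < L := by
    intro x hx
    have h1 : ‖x - x0‖ ^ 2 / L ^ 2 < 1 := by simp only [hS] at hx; linarith
    rw [div_lt_one (by positivity)] at h1
    exact lt_of_pow_lt_pow_left₀ 2 hL.le h1
  have hKc : IsCompact K := by
    refine (isCompact_closedBall x0 L).of_isClosed_subset
      (isClosed_le continuous_const hScont) ?_
    intro x hx
    have := hnorm x (lt_of_lt_of_le hσ0 hx)
    simpa [dist_eq_norm] using this.le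
  have hx0K : x0 ∈ K := by simp [hK, hS, hσ1.le]
  set f : Euc d → ℝ := fun x => φ x - L * S x ^ (-γ) with hf
  have hfc : ContinuousOn f K := by
    refine hφ.continuous.continuousOn.sub (continuousOn_const.mul ?_)
    refine hScont.continuousOn.rpow_const ?_
    intro x hx
    exact Or.inl (lt_of_lt_of_le hσ0 hx).ne'
  obtain ⟨x1, hx1K, hx1max⟩ := hKc.exists_isMaxOn ⟨x0, hx0K⟩ hfc
  have hx1σ : σ < S x1 := by
    refine lt_of_le_of_ne hx1K fun heq => ?_
    have h1 : f x0 ≤ f x1 := hx1max hx0K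
    have h2 : φ x1 ≤ M := hM' x1 (hnorm x1 (lt_of_lt_of_le hσ0 hx1K)).le
    simp only [hf, ← heq] at h1
    simp [hS] at h1
    linarith
  have hloc : IsLocalMax f x1 := by
    have : K ∈ nhds x1 := by
      filter_upwards [hScont.continuousAt.eventually (lt_mem_nhds hx1σ)] with y hy
      exact le_of_lt hy
    exact hx1max.isLocalMax this
  set z := x1 - x0 with hz
  set s := S x1 with hs
  have hspos : 0 < s := hσ0.trans hx1σ
  have key : ∀ i : Fin d,
      fderiv ℝ φ x1 (EuclideanSpace.single i 1) = L * γ * s ^ (-γ - 1) * (2 * z i / L ^ 2) ∧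
      fderiv ℝ (fun y => fderiv ℝ φ y (EuclideanSpace.single i 1)) x1 (EuclideanSpace.single i 1)
       ≤ L * γ * (γ + 1) * s ^ (-γ - 2) * (2 * z i / L ^ 2) ^ 2
        + L * γ * s ^ (-γ - 1) * (2 / L ^ 2) := by
    intro i
    have hSline : ∀ t : ℝ, S (x1 + t • EuclideanSpace.single i (1:ℝ)) =
        s - (2 * t * z i + t ^ 2) / L ^ 2 := by
      intro t
      have : x1 + t • EuclideanSpace.single i (1:ℝ) - x0 = z + t • EuclideanSpace.single i (1:ℝ) := by
        rw [hz]; abel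
      simp only [hs, hS, this, aux_normsq]
      ring
    have hcont : Continuous (fun t : ℝ => x1 + t • EuclideanSpace.single i (1:ℝ)) := by fun_prop
    have h1 : ∀ᶠ t in nhds (0:ℝ), s - (2 * t * z i + t ^ 2) / L ^ 2 ≠ 0 := by
      have hc : ContinuousAt (fun t : ℝ => s - (2 * t * z i + t ^ 2) / L ^ 2) 0 := by fun_prop
      exact hc.eventually_ne (by simpa using hspos.ne')
    have h2 : IsLocalMax (fun t : ℝ => φ (x1 + t • EuclideanSpace.single i (1:ℝ)) -
        L * (s - (2 * t * z i + t ^ 2) / L ^ 2) ^ (-γ)) 0 := by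
      have h3 : Tendsto (fun t : ℝ => x1 + t • EuclideanSpace.single i (1:ℝ)) (nhds 0) (nhds x1) := by
        have := hcont.tendsto 0
        simpa using this
      filter_upwards [h3.eventually hloc] with t ht
      simp only [hf, hSline] at ht
      simpa using ht
    have h4 := aux_second_deriv
      (u' := fun t => fderiv ℝ φ (x1 + t • EuclideanSpace.single i (1:ℝ)) (EuclideanSpace.single i (1:ℝ))
        - L * γ * (s - (2 * t * z i + t ^ 2) / L ^ 2) ^ (-γ - 1) * ((2 * z i + 2 * t) / L ^ 2))
      (by
        filter_upwards [h1] with t ht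
        exact (aux_line1 hφ x1 _ t).sub (aux_barrier_deriv L L γ s (z i) t ht))
      ((aux_line2 hφ x1 (EuclideanSpace.single i (1:ℝ))).sub
        (aux_barrier_deriv2 L L γ s (z i) hspos.ne')) h2
    obtain ⟨h5, h6⟩ := h4
    refine ⟨?_, by linarith⟩
    simp at h5
    linarith
  -- gradient
  have hgrad : gradient φ x1 = (L * γ * s ^ (-γ - 1) * (2 / L ^ 2)) • z := by
    ext i
    rw [aux_grad hφ, (key i).1]
    simp
    ring
  set t := ‖z‖ / L with ht
  have hzt : ‖z‖ = t * L := by rw [ht]; field_simp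
  have hst : s = 1 - t ^ 2 := by
    simp only [hs, hS]; rw [← hz, hzt]; field_simp
  have hgn : ‖gradient φ x1‖ = 2 * γ * t * (1 - t ^ 2) ^ (-γ - 1) := by
    rw [hgrad, norm_smul, Real.norm_of_nonneg (by positivity), hzt, hst]
    field_simp
  have hsum : ∑ i, (z i) ^ 2 = ‖z‖ ^ 2 := by
    rw [EuclideanSpace.norm_sq_eq]; simp
  have hlap : lap φ x1 ≤ (2 * γ / L) * d * (1 - t ^ 2) ^ (-γ - 1) +
        (4 * γ * (γ + 1) / L) * t ^ 2 * (1 - t ^ 2) ^ (-γ - 2) := by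
    unfold lap
    refine (Finset.sum_le_sum fun i _ => (key i).2).trans (le_of_eq ?_)
    rw [Finset.sum_add_distrib, ← Finset.mul_sum]
    have : ∑ i, (2 * z i / L ^ 2) ^ 2 = 4 / L ^ 4 * (t * L) ^ 2 := by
      rw [← hzt, ← hsum, Finset.mul_sum]
      refine Finset.sum_congr rfl fun i _ => ?_
      field_simp
      ring
    rw [this, hst]
    simp
    field_simp
    ring
  have h1 := hsub x1 (hnorm x1 hspos)
  have h2 := halg t (by positivity) (by rw [ht, div_lt_one hL]; exact hnorm x1 hspos)
  rw [hgn] at h1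
  linarith

theorem aux_upper (d : ℕ) (hd : 1 ≤ d) (m ρ R a R' : ℝ) (hm : 1 < m)
    (hρ : 0 < ρ) (hR : 0 < R)
    (mst : ℝ) (hmst : mst = m / (m - 1))
    (b : Euc d → Euc d) (V : Euc d → ℝ) (α : Euc d → ℝ)
    (hb : ∀ x : Euc d, R ≤ ‖x‖ → b x = ((ρ + α x) * ‖x‖ ^ ((0:ℝ) - 1)) • x)
    (hα : ∀ x : Euc d, R ≤ ‖x‖ → α x = a * ‖x‖⁻¹)
    (hR' : R < R') (hsupp : Function.support V ⊆ Metric.ball (0 : Euc d) R')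
    (β lam : ℝ) (φ : Euc d → ℝ) (hφ : IsSubsol m b V β lam φ) : lam ≤ ρ ^ mst / mst := by
  by_contra! hlt
  have hm1 : 0 < m - 1 := by linarith
  have hmstpos : 0 < mst := by rw [hmst]; exact div_pos (by linarith) hm1
  have hconj : mst.HolderConjugate m := by
    apply Real.HolderConjugate.symm
    rw [Real.holderConjugate_iff]
    refine ⟨hm, ?_⟩
    rw [hmst]; field_simp; ring
  have hcont : ContinuousAt (fun q : ℝ => q ^ mst / mst) ρ :=
    (Real.continuousAt_rpow_const ρ mst (Or.inl hρ.ne')).div_const mst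
  have hev : ∀ᶠ q in nhdsWithin ρ (Set.Ioi ρ), q ^ mst / mst < lam :=
    (hcont.eventually (gt_mem_nhds hlt)).filter_mono nhdsWithin_le_nhds
  obtain ⟨q, hq, hqρ⟩ := (hev.and self_mem_nhdsWithin).exists
  have hqρ : ρ < q := hqρ
  have hq0 : 0 < q := hρ.trans hqρ
  set q' := (ρ + q) / 2 with hq'
  have hq'0 : 0 < q' := by positivity
  set μ := q' / q with hμ
  have hμ0 : 0 < μ := by positivity
  have hμ1 : μ < 1 := by rw [hμ, div_lt_one hq0]; linarith
  have hμm : μ ^ m < 1 := Real.rpow_lt_one hμ0.le hμ1 (by linarith)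
  have hθ : 0 < (1 - μ ^ m) / m := div_pos (by linarith) (by linarith)
  obtain ⟨L, hL, hno⟩ := aux_no (d := d) m (lam - q ^ mst / mst) ((1 - μ ^ m) / m) hm
    (by linarith) hθ
  set R2 := max R' (|a| / (q' - ρ)) with hR2
  have hqq : 0 < q' - ρ := by rw [hq']; linarith
  have hbn : ∀ x, R2 ≤ ‖x‖ → ‖b x‖ ≤ q' := by
    intro x hx
    have h1 : R' ≤ ‖x‖ := (le_max_left _ _).trans hx
    have h2 : |a| / (q' - ρ) ≤ ‖x‖ := (le_max_right _ _).trans hx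
    have hx0 : 0 < ‖x‖ := by linarith
    rw [hb x (by linarith), hα x (by linarith), norm_smul, Real.norm_eq_abs, abs_mul,
      abs_of_nonneg (Real.rpow_nonneg hx0.le _), zero_sub, Real.rpow_neg_one, mul_assoc,
      inv_mul_cancel₀ hx0.ne', mul_one]
    have h3 : |a| * ‖x‖⁻¹ ≤ q' - ρ := by
      rw [div_le_iff₀ hqq] at h2
      rw [← div_eq_mul_inv, div_le_iff₀ hx0]
      linarith
    calc |ρ + a * ‖x‖⁻¹| ≤ |ρ| + |a * ‖x‖⁻¹| := abs_add_le _ _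
      _ = ρ + |a| * ‖x‖⁻¹ := by rw [abs_of_pos hρ, abs_mul, abs_of_pos (inv_pos.2 hx0)]
      _ ≤ q' := by linarith
  set x0 : Euc d := EuclideanSpace.single (⟨0, hd⟩ : Fin d) (R2 + L) with hx0
  have hR2pos : 0 < R2 := lt_of_lt_of_le (by linarith) (le_max_left _ _)
  have hx0n : ‖x0‖ = R2 + L := by
    rw [hx0, EuclideanSpace.norm_single, Real.norm_of_nonneg (by positivity)]
  refine hno x0 φ hφ.1 fun x hx => ?_
  have hxn : R2 ≤ ‖x‖ := by
    have := norm_sub_norm_le x0 x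
    rw [norm_sub_rev] at this
    linarith
  have hV : V x = 0 := by
    by_contra hne
    have := hsupp (Function.mem_support.2 hne)
    rw [mem_ball_zero_iff] at this
    have := le_max_left R' (|a| / (q' - ρ))
    linarith
  have h1 := hφ.2 x
  rw [hV] at h1
  set p := gradient φ x with hp
  have h2 : -(‖b x‖ * ‖p‖) ≤ ⟪b x, p⟫ := by
    have := abs_real_inner_le_norm (b x) p
    linarith [neg_abs_le ⟪b x, p⟫]
  have h3 : ‖b x‖ * ‖p‖ ≤ q ^ mst / mst + μ ^ m * ‖p‖ ^ m / m := by
    have h4 : ‖b x‖ * ‖p‖ ≤ q' * ‖p‖ := by gcongr; exact hbn x hxn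
    have h5 : q' * ‖p‖ = q * (μ * ‖p‖) := by rw [hμ]; field_simp
    have h6 := Real.young_inequality_of_nonneg hq0.le (by positivity : 0 ≤ μ * ‖p‖) hconj
    rw [Real.mul_rpow hμ0.le (norm_nonneg _)] at h6
    linarith
  have h7 : (1 - μ ^ m) / m * ‖p‖ ^ m = (1 / m) * ‖p‖ ^ m - μ ^ m * ‖p‖ ^ m / m := by ring
  rw [h7]
  linarith

theorem aux_lower (d : ℕ) (m ρ R a : ℝ) (hm : 1 < m)
    (hρ : 0 < ρ) (hR : 0 < R)
    (mst : ℝ) (hmst : mst = m / (m - 1))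
    (b : Euc d → Euc d) (V : Euc d → ℝ) (α : Euc d → ℝ)
    (hH0 : HypH0 0 ρ R b V α)
    (hα : ∀ x : Euc d, R ≤ ‖x‖ → α x = a * ‖x‖⁻¹)
    (ha : (d : ℝ) - 1 ≤ a) :
    ∃ β₀ : ℝ, 0 < β₀ ∧ ∀ β : ℝ, β₀ ≤ β → ∃ φ, IsSubsol m b V β (ρ ^ mst / mst) φ := by
  obtain ⟨hbC, hVC, -, -, hb, -, hV0, hVR, -⟩ := hH0
  have hm1 : 0 < m - 1 := by linarith
  set c := ρ ^ (1 / (m - 1)) with hc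
  have hc0 : 0 < c := by positivity
  let χ : ContDiffBump (0 : Euc d) := ⟨R / 2, R, by linarith, by linarith⟩
  set φ : Euc d → ℝ := fun x => (1 - χ x) * (-c * ‖x‖) with hφdef
  have hφ : ContDiff ℝ 3 φ := by
    rw [contDiff_iff_contDiffAt]
    intro x
    by_cases hx : x = 0
    · have h1 : φ =ᶠ[nhds x] fun _ => 0 := by
        subst hx
        filter_upwards [χ.eventuallyEq_one] with y hy
        simp [hφdef, hy]
      exact contDiffAt_const.congr_of_eventuallyEq h1
    · exact (contDiffAt_const.sub χ.contDiffAt).mul (contDiffAt_const.mul (contDiffAt_norm ℝ hx))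
  have hφeq : ∀ x, R < ‖x‖ → φ =ᶠ[nhds x] fun y => -c * ‖y‖ := by
    intro x hx
    filter_upwards [continuous_norm.continuousAt.eventually (lt_mem_nhds hx)] with y hy
    have : χ y = 0 := χ.zero_of_le_dist (by simpa using hy.le)
    simp [hφdef, this]
  -- outer region
  have houter : ∀ x, R < ‖x‖ →
      ρ ^ mst / mst - lap φ x + ⟪b x, gradient φ x⟫ + (1 / m) * ‖gradient φ x‖ ^ m ≤ 0 := by
    intro x hx
    set r := ‖x‖ with hr
    have hr0 : 0 < r := hR.trans hx
    have key : ∀ i : Fin d,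
        fderiv ℝ φ x (EuclideanSpace.single i 1) = -c * (x i / r) ∧
        fderiv ℝ (fun y => fderiv ℝ φ y (EuclideanSpace.single i 1)) x (EuclideanSpace.single i 1)
          = -c * (1 / r - x i ^ 2 / r ^ 3) := by
      intro i
      have h3 : Tendsto (fun t : ℝ => x + t • EuclideanSpace.single i (1:ℝ)) (nhds 0) (nhds x) := by
        have hcont : Continuous (fun t : ℝ => x + t • EuclideanSpace.single i (1:ℝ)) := by fun_prop
        have := hcont.tendsto 0
        simpa using this
      have h4 : (fun t : ℝ => φ (x + t • EuclideanSpace.single i (1:ℝ))) =ᶠ[nhds 0]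
          fun t => -c * √(r ^ 2 + (2 * t * x i + t ^ 2)) := by
        filter_upwards [h3.eventually (hφeq x hx)] with t ht
        rw [ht, hr, ← aux_normsq, Real.sqrt_sq (norm_nonneg _)]
      have h1 : ∀ᶠ t in nhds (0:ℝ), r ^ 2 + (2 * t * x i + t ^ 2) ≠ 0 := by
        have hc : ContinuousAt (fun t : ℝ => r ^ 2 + (2 * t * x i + t ^ 2)) 0 := by fun_prop
        exact hc.eventually_ne (by simpa using hr0.ne')
      have h5 : (fun t : ℝ => fderiv ℝ φ (x + t • EuclideanSpace.single i (1:ℝ))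
          (EuclideanSpace.single i (1:ℝ))) =ᶠ[nhds 0]
          fun t => -c * ((x i + t) / √(r ^ 2 + (2 * t * x i + t ^ 2))) := by
        filter_upwards [h4.eventuallyEq_nhds, h1] with t ht ht1
        exact (aux_line1 hφ x _ t).unique
          ((aux_norm_deriv c (r ^ 2) (x i) t ht1).congr_of_eventuallyEq ht)
      constructor
      · have := h5.self_of_nhds
        simpa [Real.sqrt_sq hr0.le] using this
      · exact (aux_line2 hφ x _).unique
          ((aux_norm_deriv2 c r (x i) hr0).congr_of_eventuallyEq h5)
    have hgrad : gradient φ x = (-c / r) • x := by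
      ext i
      rw [aux_grad hφ, (key i).1]
      simp
      ring
    have hsum : ∑ i, (x i) ^ 2 = r ^ 2 := by
      rw [hr, EuclideanSpace.norm_sq_eq]; simp
    have hlap : lap φ x = -c * (d - 1) / r := by
      unfold lap
      rw [Finset.sum_congr rfl fun i _ => (key i).2, ← Finset.mul_sum, Finset.sum_sub_distrib,
        ← Finset.sum_div, ← Finset.sum_div, hsum]
      simp
      field_simp
    have hgn : ‖gradient φ x‖ = c := by
      rw [hgrad, norm_smul, ← hr, norm_div, norm_neg, Real.norm_of_nonneg hc0.le,
        Real.norm_of_nonneg hr0.le]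
      field_simp
    have hin : ⟪b x, gradient φ x⟫ = -c * (ρ + a / r) := by
      rw [hgrad, hb x hx.le, hα x hx.le, inner_smul_left, inner_smul_right,
        real_inner_self_eq_norm_sq, ← hr, zero_sub, Real.rpow_neg_one]
      simp
      field_simp
    have hcm : c ^ m = ρ ^ mst := by
      rw [hc, ← Real.rpow_mul hρ.le, hmst]; congr 1; field_simp
    have hcρ : c * ρ = ρ ^ mst := by
      have h1 : c * ρ = ρ ^ (1 / (m - 1)) * ρ ^ (1:ℝ) := by rw [Real.rpow_one]
      rw [h1, ← Real.rpow_add hρ, hmst]; congr 1; field_simp; ring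
    have hcoef : ρ ^ mst / mst + (1 / m) * ρ ^ mst = ρ ^ mst := by
      rw [hmst]; field_simp; ring
    rw [hlap, hgn, hin, hcm]
    have : ρ ^ mst / mst - -c * (d - 1) / r + -c * (ρ + a / r) + (1 / m) * ρ ^ mst =
        (ρ ^ mst / mst + (1 / m) * ρ ^ mst - c * ρ) - c * (a - (d - 1)) / r := by ring
    rw [this, hcoef, hcρ]
    have : 0 ≤ c * (a - (d - 1)) / r := by
      apply div_nonneg (mul_nonneg hc0.le (by linarith)) hr0.le
    linarith
  -- inner region
  have hFc : Continuous (fun x => ρ ^ mst / mst - lap φ x + ⟪b x, gradient φ x⟫ +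
      (1 / m) * ‖gradient φ x‖ ^ m) := by
    have h1 := aux_contlap hφ
    have h2 := aux_contgrad hφ
    have h3 := hbC.continuous
    have h4 : Continuous (fun x => ‖gradient φ x‖ ^ m) :=
      h2.norm.rpow_const fun x => Or.inr (by linarith)
    exact ((continuous_const.sub h1).add (h3.inner h2)).add (continuous_const.mul h4)
  have hcomp := isCompact_closedBall (0 : Euc d) R
  obtain ⟨M, hM⟩ := (hcomp.image hFc).bddAbove
  obtain ⟨y, hy, hymin⟩ := hcomp.exists_isMinOn ⟨0, by simp [hR.le]⟩ hVC.continuous.continuousOn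
  have hVy : 0 < V y :=
    lt_of_le_of_ne (hV0 y) (Ne.symm (Function.mem_support.1 (interior_subset (hVR hy))))
  refine ⟨|M| / V y + 1, by positivity, fun β hβ => ⟨φ, hφ, fun x => ?_⟩⟩
  have hβ0 : 0 ≤ β := by
    have : 0 ≤ |M| / V y := by positivity
    linarith
  rcases lt_or_ge R ‖x‖ with hx | hx
  · have := houter x hx
    have := mul_nonneg hβ0 (hV0 x)
    linarith
  · have hx' : x ∈ Metric.closedBall (0 : Euc d) R := by simpa using hx
    have h1 := hM ⟨x, hx', rfl⟩
    have h2 : V y ≤ V x := hymin hx'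
    have h3 : |M| ≤ β * V y := by
      rw [← div_le_iff₀ hVy]; linarith
    have h4 : β * V y ≤ β * V x := by gcongr
    have := le_abs_self M
    simp only at h1
    linarith

theorem stmt14 (d : ℕ) (hd : 1 ≤ d) (m ρ R a R' : ℝ) (hm : 1 < m)
    (hρ : 0 < ρ) (hR : 0 < R)
    (mst : ℝ) (hmst : mst = m / (m - 1))
    (b : Euc d → Euc d) (V : Euc d → ℝ) (α : Euc d → ℝ)
    (hH0 : HypH0 0 ρ R b V α)
    (hα : ∀ x : Euc d, R ≤ ‖x‖ → α x = a * ‖x‖⁻¹)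
    (hR' : R < R') (hsupp : Function.support V ⊆ Metric.ball (0 : Euc d) R')
    (ha : (d : ℝ) - 1 ≤ a) :
    Tendsto (fun β : ℝ => lamMax m b V β) atTop (nhds (ρ ^ mst / mst)) ∧
      ∃ β₀ : ℝ, 0 < β₀ ∧ ∀ β : ℝ, β₀ ≤ β → lamMax m b V β = ρ ^ mst / mst := by

  have hgr : ∃ β₀ : ℝ, 0 < β₀ ∧ ∀ β : ℝ, β₀ ≤ β → lamMax m b V β = ρ ^ mst / mst := by
    obtain ⟨β₀, h0, h⟩ := aux_lower d m ρ R a hm hρ hR mst hmst b V α hH0 hα ha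
    refine ⟨β₀, h0, fun β hβ => ?_⟩
    have hG : IsGreatest {lam : ℝ | ∃ φ : Euc d → ℝ, IsSubsol m b V β lam φ} (ρ ^ mst / mst) := by
      refine ⟨h β hβ, ?_⟩
      rintro lam ⟨φ, hφ⟩
      exact aux_upper d hd m ρ R a R' hm hρ hR mst hmst b V α hH0.2.2.2.2.1 hα hR' hsupp β lam φ hφ
    exact hG.csSup_eq
  refine ⟨?_, hgr⟩
  obtain ⟨β₀, -, h⟩ := hgr
  refine tendsto_const_nhds.congr' ?_
  filter_upwards [eventually_ge_atTop β₀] with β hβ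
  exact (h β hβ).symm

end
end
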